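/- arXiv:1103.3423 — 3 statements merged into one kernel-verified Lean document; each statement's English description precedes it below -/
import Mathlib

section
/- Let k ≥ 0 and n ≥ 2k+1, and let L ≥ 1. There is a constant C(n,L) > 0 with the following property: for every finite k-dimensional simplicial complex X with N ≥ 2 vertices in which every vertex belongs to at most L faces, there exists a topological embedding I of the polyhedron |X| into the closed ball of radius C(n,L)·N^{1/(n−k)}·(log N)^{2k+2} in ℝⁿ such that I has combinatorial thickness at least 1. -/
open scoped Classical
open Metric Set Function

/-- An embedding `I` of the polyhedron of a geometric simplicial complex `X` has
combinatorial thickness at least `T` if the images of the convex hulls of any two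
disjoint faces are at Euclidean distance at least `T` from each other. -/
def HasCombThickness {E F : Type*} [NormedAddCommGroup E] [NormedSpace ℝ E]
    [NormedAddCommGroup F] [NormedSpace ℝ F]
    (X : Geometry.SimplicialComplex ℝ E) (I : X.space → F) (T : ℝ) : Prop :=
  ∀ s ∈ X.faces, ∀ t ∈ X.faces, Disjoint s t →
    ∀ x y : X.space, (x : E) ∈ convexHull ℝ (s : Set E) →
      (y : E) ∈ convexHull ℝ (t : Set E) → T ≤ dist (I x) (I y)


lemma count_update {ι α : Type*} [Fintype ι] [DecidableEq ι] [Fintype α]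
    (v : ι) (Q E : (ι → α) → Prop) (K : ℕ)
    (hQ : ∀ P u, Q (update P v u) ↔ Q P)
    (hE : ∀ P, (Finset.univ.filter (fun u => E (update P v u))).card ≤ K) :
    Fintype.card α * (Finset.univ.filter (fun P => Q P ∧ E P)).card ≤
      K * (Finset.univ.filter (fun P => Q P)).card := by
  -- double counting over pairs (P, u) with Q P and E (update P v u)
  have h1 : ((Finset.univ : Finset ((ι → α) × α)).filter
      (fun x => Q x.1 ∧ E (update x.1 v x.2))).card ≤
      K * (Finset.univ.filter (fun P => Q P)).card := by
    rw [Finset.card_eq_sum_card_fiberwise (f := Prod.fst)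
      (t := (Finset.univ.filter (fun P => Q P)))]
    · rw [mul_comm, ← smul_eq_mul, ← Finset.sum_const]
      apply Finset.sum_le_sum
      intro P _
      refine le_trans ?_ (hE P)
      apply Finset.card_le_card_of_injOn Prod.snd
      · rintro ⟨P', u⟩ h
        simp only [Finset.coe_filter, Finset.mem_filter, Finset.mem_univ, true_and,
          Set.mem_ofPred_eq] at h ⊢
        obtain ⟨⟨_, h⟩, rfl⟩ := h
        exact h
      · rintro ⟨P', u⟩ h ⟨P'', u'⟩ h' huu
        simp only [Finset.coe_filter, Finset.mem_filter, Finset.mem_univ, true_and,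
          Set.mem_ofPred_eq] at h h' huu
        rw [h.2, h'.2, huu]
    · rintro ⟨P', u⟩ h
      simp only [Finset.coe_filter, Finset.mem_univ, true_and,
          Set.mem_ofPred_eq] at h ⊢
      exact h.1
  refine le_trans ?_ h1
  -- injection (u, P) ↦ (update P v u, P v)
  rw [← Finset.card_univ, ← Finset.card_product]
  apply Finset.card_le_card_of_injOn (fun x : α × (ι → α) => (update x.2 v x.1, x.2 v))
  · rintro ⟨u, P⟩ h
    simp only [Finset.coe_product, Finset.coe_univ, Finset.coe_filter, Finset.mem_univ, true_and,
      Set.mem_prod, Set.mem_univ, Set.mem_ofPred_eq] at h ⊢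
    refine ⟨(hQ _ _).2 h.1, ?_⟩
    simpa using h.2
  · rintro ⟨u, P⟩ h ⟨u', P'⟩ h' he
    simp only [Prod.mk.injEq] at he
    obtain ⟨h1, h2⟩ := he
    have hu : u = u' := by simpa using congrFun h1 v
    subst hu
    refine Prod.ext rfl ?_
    funext w
    by_cases hw : w = v
    · subst hw; exact h2
    · simpa [hw] using congrFun h1 w

lemma count_update_multi {ι α κ : Type*} [Fintype ι] [DecidableEq ι] [Fintype α]
    (v : κ → ι) (E : κ → (ι → α) → Prop) (K : ℕ)
    (hind : ∀ i j, i ≠ j → ∀ P u, E i (update P (v j) u) ↔ E i P)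
    (hE : ∀ i P, (Finset.univ.filter (fun u => E i (update P (v i) u))).card ≤ K)
    (S : Finset κ) :
    (Fintype.card α) ^ S.card * (Finset.univ.filter (fun P => ∀ i ∈ S, E i P)).card ≤
      K ^ S.card * Fintype.card (ι → α) := by
  induction S using Finset.induction_on with
  | empty => simp [Finset.card_univ]
  | insert m S hm ih =>
    have key := count_update (v m) (fun P => ∀ i ∈ S, E i P) (E m) K
      (fun P u => forall₂_congr fun i hi => hind i m (fun h => hm (h ▸ hi)) P u)
      (hE m)
    have key' : Fintype.card α * (Finset.univ.filter (fun P => (∀ i ∈ S, E i P) ∧ E m P)).card ≤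
        K * (Finset.univ.filter (fun P => ∀ i ∈ S, E i P)).card := by convert key
    have e : (Finset.univ.filter (fun P => ∀ i ∈ insert m S, E i P)) =
        (Finset.univ.filter (fun P => (∀ i ∈ S, E i P) ∧ E m P)) := by
      ext P
      simp only [Finset.mem_filter, Finset.mem_univ, true_and, Finset.forall_mem_insert]
      exact and_comm
    rw [e, Finset.card_insert_of_notMem hm, pow_succ, pow_succ, mul_assoc]
    calc _ ≤ Fintype.card α ^ S.card *
          (K * (Finset.univ.filter (fun P => ∀ i ∈ S, E i P)).card) :=
          Nat.mul_le_mul_left _ key'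
      _ = K * (Fintype.card α ^ S.card *
          (Finset.univ.filter (fun P => ∀ i ∈ S, E i P)).card) := by ring
      _ ≤ K * (K ^ S.card * Fintype.card (ι → α)) := Nat.mul_le_mul_left _ ih
      _ = _ := by ring

lemma count_interval (r : ℕ) (A β : ℝ) (H k : ℕ) (hβ : 1 ≤ β * (k + 1)) :
    (Finset.univ.filter (fun u : Fin r => |A + β * (u : ℕ)| ≤ H)).card ≤
      2 * H * (k + 1) + 1 := by
  set S := (Finset.univ.filter (fun u : Fin r => |A + β * (u : ℕ)| ≤ H))
  by_cases hS : S.Nonempty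
  · have hu0 := S.min'_mem hS
    set u0 := S.min' hS
    have : S.card ≤ (Finset.Icc (u0 : ℕ) (u0 + 2 * H * (k + 1))).card := by
      apply Finset.card_le_card_of_injOn (fun u : Fin r => (u : ℕ))
      · intro u hu
        have h1 : u0 ≤ u := S.min'_le u hu
        have h2 : |A + β * (u : ℕ)| ≤ H := (Finset.mem_filter.1 hu).2
        have h3 : |A + β * (u0 : ℕ)| ≤ H := (Finset.mem_filter.1 hu0).2
        rw [abs_le] at h2 h3
        simp only [Finset.coe_Icc, Set.mem_Icc]
        refine ⟨h1, ?_⟩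
        have h1' : ((u0 : ℕ) : ℝ) ≤ ((u : ℕ) : ℝ) := by exact_mod_cast h1
        have h4 : β * ((u : ℕ) - (u0 : ℕ) : ℝ) ≤ 2 * H := by linarith
        have h5 : ((u : ℕ) - (u0 : ℕ) : ℝ) ≤ 2 * H * (k + 1) := by
          have hk : (0 : ℝ) ≤ k + 1 := by positivity
          nlinarith [mul_le_mul_of_nonneg_right h4 hk,
            mul_le_mul_of_nonneg_right hβ (sub_nonneg.2 h1')]
        have h6 : ((u : ℕ) : ℝ) ≤ ((u0 + 2 * H * (k + 1) : ℕ) : ℝ) := by push_cast; linarith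
        exact_mod_cast h6
      · intro a _ b _ h
        exact Fin.ext h
    rw [Nat.card_Icc] at this
    omega
  · rw [Finset.not_nonempty_iff_eq_empty] at hS
    simp [hS]

lemma count_box (n r : ℕ) (A : Fin n → ℝ) (β : ℝ) (H k : ℕ) (hβ : 1 ≤ β * (k + 1)) :
    (Finset.univ.filter (fun u : Fin n → Fin r => ∀ l, |A l + β * (u l : ℕ)| ≤ H)).card ≤
      (2 * H * (k + 1) + 1) ^ n := by
  have : (Finset.univ.filter (fun u : Fin n → Fin r => ∀ l, |A l + β * (u l : ℕ)| ≤ H)) ⊆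
      Fintype.piFinset (fun l => Finset.univ.filter (fun u : Fin r => |A l + β * (u : ℕ)| ≤ H)) := by
    intro u hu
    simpa using hu
  refine (Finset.card_le_card this).trans ?_
  rw [Fintype.card_piFinset]
  refine (Finset.prod_le_pow_card _ _ _ (fun l _ => count_interval r (A l) β H k hβ)).trans ?_
  simp

lemma card_piAntidiag_le {ι : Type*} [DecidableEq ι] (s : Finset ι) (M k : ℕ)
    (hs : s.card ≤ k + 1) : (s.piAntidiag M).card ≤ (M + 1) ^ k := by
  rcases s.eq_empty_or_nonempty with rfl | ⟨v, hv⟩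
  · by_cases hM : M = 0
    · subst hM; simp
    · simp [hM]
  · have : (s.piAntidiag M).card ≤
        (Finset.univ : Finset ({w // w ∈ s.erase v} → Fin (M + 1))).card := by
      apply Finset.card_le_card_of_injOn
        (fun a (w : {w // w ∈ s.erase v}) => Fin.ofNat (M + 1) (a w))
      · intro a _; simp
      · intro a ha b hb hab
        simp only [Finset.mem_coe, Finset.mem_piAntidiag] at ha hb
        have le : ∀ a : ι → ℕ, s.sum a = M → ∀ w ∈ s, a w ≤ M := fun a h w hw => by
          rw [← h]; exact Finset.single_le_sum (f := a) (fun _ _ => Nat.zero_le _) hw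
        have heq : ∀ w ∈ s.erase v, a w = b w := by
          intro w hw
          have h := congrArg Fin.val (congrFun hab ⟨w, hw⟩)
          have hws := Finset.mem_of_mem_erase hw
          have := le a ha.1 w hws
          have := le b hb.1 w hws
          simp only [Fin.ofNat] at h
          rwa [Nat.mod_eq_of_lt (by omega), Nat.mod_eq_of_lt (by omega)] at h
        have hsum : a v = b v := by
          have h1 := Finset.add_sum_erase s a hv
          have h2 := Finset.add_sum_erase s b hv
          rw [Finset.sum_congr rfl heq, ha.1, ← hb.1] at h1
          rw [← h1] at h2
          exact (Nat.add_right_cancel h2).symm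
        funext w
        by_cases hw : w ∈ s
        · by_cases hwv : w = v
          · rw [hwv, hsum]
          · exact heq w (Finset.mem_erase.2 ⟨hwv, hw⟩)
        · have h1 : a w = 0 := by by_contra h; exact hw (ha.2 w h)
          have h2 : b w = 0 := by by_contra h; exact hw (hb.2 w h)
          rw [h1, h2]
    refine this.trans ?_
    rw [Finset.card_univ]
    simp only [Fintype.card_pi, Fintype.card_fin, Finset.prod_const, Finset.card_univ, Fintype.card_coe]
    apply Nat.pow_le_pow_right (by omega)
    rw [Finset.card_erase_of_mem hv]; omega

lemma greedy_color {ι : Type*} (S : Finset ι) (r : ι → ι → Prop) (hr : ∀ a b, r a b → r b a) (D : ℕ)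
    (hD : ∀ a ∈ S, (S.filter (fun b => r a b)).card ≤ D) :
    ∃ c : ι → Fin (D + 1), ∀ a ∈ S, ∀ b ∈ S, a ≠ b → r a b → c a ≠ c b := by
  suffices h : ∀ T ⊆ S, ∃ c : ι → Fin (D + 1), ∀ a ∈ T, ∀ b ∈ T, a ≠ b → r a b → c a ≠ c b from
    h S subset_rfl
  intro T
  induction T using Finset.induction_on with
  | empty => intro _; exact ⟨fun _ => 0, by simp⟩
  | insert v T hv ih =>
    intro hT
    obtain ⟨c, hc⟩ := ih ((Finset.subset_insert _ _).trans hT)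
    have hvS : v ∈ S := hT (Finset.mem_insert_self _ _)
    have : ∃ x : Fin (D + 1), x ∉ ((S.filter (fun b => r v b)).image c) := by
      by_contra! hcon
      have : (Finset.univ : Finset (Fin (D + 1))) ⊆ ((S.filter (fun b => r v b)).image c) :=
        fun x _ => hcon x
      have h2 := (Finset.card_le_card this).trans (Finset.card_image_le.trans (hD v hvS))
      simp at h2
    obtain ⟨x, hx⟩ := this
    have key : ∀ b ∈ T, r v b → x ≠ c b := by
      intro b hb hrb hxb
      exact hx (Finset.mem_image.2 ⟨b, Finset.mem_filter.2
        ⟨hT (Finset.mem_insert_of_mem hb), hrb⟩, hxb.symm⟩)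
    refine ⟨update c v x, ?_⟩
    intro a ha b hb hab hrab
    rw [Finset.mem_insert] at ha hb
    rcases ha with rfl | ha <;> rcases hb with rfl | hb
    · exact absurd rfl hab
    · have : b ≠ a := fun h => hab h.symm
      simpa [this] using key b hb hrab
    · simpa [hab] using (key a ha (hr _ _ hrab)).symm
    · have h1 : a ≠ v := fun h => hv (h ▸ ha)
      have h2 : b ≠ v := fun h => hv (h ▸ hb)
      simpa [h1, h2] using hc a ha b hb hab hrab


lemma vander_bound (n χ : ℕ) : ∃ C : ℝ, 0 ≤ C ∧ ∀ S : Finset (Fin χ), S.card ≤ n →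
    ∀ σ : S → ℝ, ∀ c, |σ c| ≤ C * ‖(fun l : Fin n => ∑ c : S, σ c * ((c : Fin χ) : ℝ) ^ (l : ℕ))‖ := by
  have h1 : ∀ S : Finset (Fin χ), ∃ C : ℝ, 0 ≤ C ∧ (S.card ≤ n → ∀ σ : S → ℝ, ∀ c, |σ c| ≤
      C * ‖(fun l : Fin n => ∑ c : S, σ c * ((c : Fin χ) : ℝ) ^ (l : ℕ))‖) := by
    intro S
    by_cases hS : S.card ≤ n
    swap
    · exact ⟨0, le_rfl, fun h => absurd h hS⟩
    let Φ : (S → ℝ) →ₗ[ℝ] (Fin n → ℝ) :=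
      { toFun := fun σ l => ∑ c : S, σ c * ((c : Fin χ) : ℝ) ^ (l : ℕ)
        map_add' := by
          intro a b; funext l; simp [add_mul, Finset.sum_add_distrib]
        map_smul' := by
          intro a b; funext l; simp [Finset.mul_sum, mul_assoc] }
    have hker : LinearMap.ker Φ = ⊥ := by
      rw [LinearMap.ker_eq_bot']
      intro σ hσ
      have e := S.equivFin
      have h0 := Matrix.eq_zero_of_forall_pow_sum_mul_pow_eq_zero
        (f := fun i : Fin S.card => (((e.symm i : Fin χ) : ℕ) : ℝ)) (v := fun i => σ (e.symm i))
        (by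
          intro i j hij
          have : ((e.symm i : Fin χ) : ℕ) = ((e.symm j : Fin χ) : ℕ) := by
            simpa using hij
          exact e.symm.injective (Subtype.ext (Fin.ext this)))
        (by
          intro j
          have := congrFun hσ ⟨j, lt_of_lt_of_le j.2 hS⟩
          simp only [Φ, LinearMap.coe_mk, AddHom.coe_mk, Pi.zero_apply] at this
          rw [← this, ← e.symm.sum_comp])
      funext c
      have := congrFun h0 (e c)
      simpa using this
    obtain ⟨K, _, hK⟩ := Φ.exists_antilipschitzWith hker
    refine ⟨K, K.2, fun _ σ c => ?_⟩
    have h2 := hK.le_mul_dist σ 0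
    rw [dist_zero_right, map_zero, dist_zero_right] at h2
    exact (norm_le_pi_norm σ c).trans h2
  choose C hC0 hC using h1
  refine ⟨∑ S, C S, Finset.sum_nonneg fun S _ => hC0 S, fun S hS σ c => ?_⟩
  refine (hC S hS σ c).trans (mul_le_mul_of_nonneg_right ?_ (norm_nonneg _))
  exact Finset.single_le_sum (f := C) (fun S _ => hC0 S) (Finset.mem_univ S)

lemma nondeg (n k χ : ℕ) (hkn : k + 1 ≤ n) : ∃ T C : ℕ, 1 ≤ T ∧
    ∀ (N : ℕ) (s : Finset (Fin N)) (col : Fin N → Fin χ), s.card ≤ k + 1 → InjOn col s →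
    ∀ e : Fin N → Fin n → ℝ, (∀ v l, |e v l| ≤ 1 / T) → ∀ (τ : Fin N → ℝ) (H : ℝ), 0 ≤ H →
    (∀ l : Fin n, |∑ v ∈ s, τ v * (((col v : Fin χ) : ℝ) ^ (l : ℕ) + e v l)| ≤ H) →
    ∀ v ∈ s, |τ v| ≤ C * H := by
  obtain ⟨C0, hC0, hC⟩ := vander_bound n χ
  obtain ⟨T, hT⟩ := exists_nat_ge (2 * C0 * (k + 1) + 1)
  obtain ⟨C, hCC⟩ := exists_nat_ge (2 * C0)
  have hT1 : (1 : ℝ) ≤ T := le_trans (by nlinarith [mul_nonneg hC0 (by positivity : (0:ℝ) ≤ (k + 1))]) hT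
  refine ⟨T, C, by exact_mod_cast hT1, ?_⟩
  intro N s col hs hinj e he τ H hH hτ v hv
  obtain ⟨w, hw, hmax⟩ := s.exists_max_image (fun v => |τ v|) ⟨v, hv⟩
  set A := |τ w| with hA
  have hA0 : 0 ≤ A := abs_nonneg _
  let S := s.image col
  have hScard : S.card ≤ n := Finset.card_image_le.trans (hs.trans hkn)
  have hinv : ∀ c : S, ∃ v, v ∈ s ∧ col v = c := fun c => by
    exact Finset.mem_image.1 c.2
  choose g hgs hgc using hinv
  have hgcol : ∀ v (hv : v ∈ s), g ⟨col v, Finset.mem_image_of_mem _ hv⟩ = v := fun v hv =>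
    hinj (hgs _) hv (hgc _)
  have hsum : ∀ l : Fin n, ∑ c : S, τ (g c) * ((c : Fin χ) : ℝ) ^ (l : ℕ) =
      ∑ v ∈ s, τ v * ((col v : Fin χ) : ℝ) ^ (l : ℕ) := by
    intro l
    symm
    refine Finset.sum_bij (fun v hv => (⟨col v, Finset.mem_image_of_mem _ hv⟩ : S)) ?_ ?_ ?_ ?_
    · intros; simp
    · intro a ha b hb hab
      exact hinj ha hb (congrArg Subtype.val hab)
    · intro c _
      exact ⟨g c, hgs c, Subtype.ext (hgc c)⟩
    · intro a ha
      rw [hgcol a ha]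
  have h1 := hC S hScard (fun c => τ (g c)) ⟨col w, Finset.mem_image_of_mem _ hw⟩
  simp only [hgcol w hw] at h1
  have h2 : ‖(fun l : Fin n => ∑ c : S, τ (g c) * ((c : Fin χ) : ℝ) ^ (l : ℕ))‖ ≤
      H + (k + 1) * A / T := by
    have hnn : 0 ≤ H + (k + 1) * A / T := by positivity
    rw [pi_norm_le_iff_of_nonneg hnn]
    intro l
    rw [hsum l, Real.norm_eq_abs]
    have e1 : ∑ v ∈ s, τ v * ((col v : Fin χ) : ℝ) ^ (l : ℕ) =
        ∑ v ∈ s, τ v * (((col v : Fin χ) : ℝ) ^ (l : ℕ) + e v l) - ∑ v ∈ s, τ v * e v l := by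
      rw [← Finset.sum_sub_distrib]; exact Finset.sum_congr rfl fun _ _ => by ring
    have e2 : |∑ v ∈ s, τ v * e v l| ≤ (k + 1) * A / T := by
      calc |∑ v ∈ s, τ v * e v l| ≤ ∑ v ∈ s, |τ v * e v l| := Finset.abs_sum_le_sum_abs _ _
        _ ≤ ∑ v ∈ s, A * (1 / T) := Finset.sum_le_sum fun v hv => by
            rw [abs_mul]; exact mul_le_mul (hmax v hv) (he v l) (abs_nonneg _) hA0
        _ = s.card * (A * (1 / T)) := by rw [Finset.sum_const, nsmul_eq_mul]
        _ ≤ (k + 1) * (A * (1 / T)) := by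
            apply mul_le_mul_of_nonneg_right _ (by positivity)
            exact_mod_cast hs
        _ = _ := by ring
    rw [e1]
    calc _ ≤ |∑ v ∈ s, τ v * (((col v : Fin χ) : ℝ) ^ (l : ℕ) + e v l)| + |∑ v ∈ s, τ v * e v l| :=
          abs_sub _ _
      _ ≤ _ := add_le_add (hτ l) e2
  have h3 : A ≤ C0 * (H + (k + 1) * A / T) := h1.trans (mul_le_mul_of_nonneg_left h2 hC0)
  have h4 : C0 * ((k + 1) * A / T) ≤ A / 2 := by
    rw [mul_div_assoc', div_le_div_iff₀ (by linarith) (by norm_num)]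
    nlinarith
  have h5 : A ≤ 2 * C0 * H := by linarith
  exact (hmax v hv).trans (h5.trans (mul_le_mul_of_nonneg_right hCC hH))


lemma exists_big_coord {ι : Type*} [DecidableEq ι] (s : Finset ι) (M k : ℕ) (hM : 1 ≤ M) (hs : s.card ≤ k + 1)
    (a : ι → ℕ) (ha : a ∈ s.piAntidiag M) : ∃ v ∈ s, M ≤ a v * (k + 1) := by
  rw [Finset.mem_piAntidiag] at ha
  by_contra! h
  have hne : s.Nonempty := by
    by_contra hne
    rw [Finset.not_nonempty_iff_eq_empty] at hne
    subst hne
    simp at ha; omega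
  have h1 : (s.sum a) * (k + 1) < s.card * M := by
    rw [Finset.sum_mul, ← smul_eq_mul, ← Finset.sum_const]
    exact Finset.sum_lt_sum_of_nonempty hne h
  rw [ha.1] at h1
  nlinarith [Nat.mul_le_mul_left M hs]

lemma stage1_random (k n N r M m H B Pb : ℕ) (hr : 1 ≤ r) (hM : 1 ≤ M)
    (F : Finset (Finset (Fin N))) (hFk : ∀ s ∈ F, s.card ≤ k + 1)
    (q : Fin N → Fin n → ℝ) (hPb : 1 ≤ Pb)
    (hP : (F.sigma (fun s => s.piAntidiag M)).card ≤ Pb)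
    (h1 : 2 * (Pb * (2 * H * (k + 1) + 1) ^ n) ≤ r ^ n)
    (h2 : (2 * B + 1) ^ n < 2 ^ m) :
    ∃ u : Fin N → Fin n → Fin r, ∀ z0 : Fin n → ℤ, (∀ l, |z0 l| ≤ B) →
      ¬ ∃ t : Fin m → Σ _ : Finset (Fin N), (Fin N → ℕ),
        (∀ i, t i ∈ F.sigma (fun s => s.piAntidiag M)) ∧
        (∀ i j, i ≠ j → Disjoint (t i).1 (t j).1) ∧
        ∀ i l, |∑ v, ((t i).2 v : ℝ) * (q v l + (u v l : ℕ) / M) - z0 l| ≤ H := by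
  by_contra! hcon
  set P := F.sigma (fun s => s.piAntidiag M) with hPdef
  set Kk := (2 * H * (k + 1) + 1) ^ n with hKk
  have hKk1 : 1 ≤ Kk := Nat.one_le_pow _ _ (by omega)
  let Zs : Finset (Fin n → ℤ) := Fintype.piFinset (fun _ => Finset.Icc (-(B : ℤ)) B)
  let Ts : Finset (Fin m → Σ _ : Finset (Fin N), (Fin N → ℕ)) := Fintype.piFinset (fun _ => P)
  let Ev : (Fin n → ℤ) → (Σ _ : Finset (Fin N), (Fin N → ℕ)) → (Fin N → Fin n → Fin r) → Prop :=
    fun z0 p u => ∀ l : Fin n, |∑ v, (p.2 v : ℝ) * (q v l + (u v l : ℕ) / M) - z0 l| ≤ H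
  let Dj : (Fin m → Σ _ : Finset (Fin N), (Fin N → ℕ)) → Prop :=
    fun t => ∀ i j, i ≠ j → Disjoint (t i).1 (t j).1
  let bad : (Fin n → ℤ) × (Fin m → Σ _ : Finset (Fin N), (Fin N → ℕ)) →
      Finset (Fin N → Fin n → Fin r) :=
    fun x => Finset.univ.filter (fun u => ∀ i ∈ (Finset.univ : Finset (Fin m)), Ev x.1 (x.2 i) u)
  have hZ : Zs.card = (2 * B + 1) ^ n := by
    simp only [Zs, Fintype.card_piFinset, Int.card_Icc, Finset.prod_const, Finset.card_univ,
      Fintype.card_fin]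
    congr 1; omega
  have hT : Ts.card ≤ Pb ^ m := by
    simp only [Ts, Fintype.card_piFinset, Finset.prod_const, Finset.card_univ, Fintype.card_fin]
    exact Nat.pow_le_pow_left hP m
  -- each bad set is small
  have hbad : ∀ x ∈ (Zs ×ˢ Ts).filter (fun x => Dj x.2),
      (r ^ n) ^ m * (bad x).card ≤ Kk ^ m * Fintype.card (Fin N → Fin n → Fin r) := by
    rintro ⟨z0, t⟩ hx
    simp only [Finset.mem_filter, Finset.mem_product] at hx
    obtain ⟨⟨_, ht⟩, hdj⟩ := hx
    have ht' : ∀ i, (t i).1 ∈ F ∧ (t i).2 ∈ (t i).1.piAntidiag M := by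
      intro i
      have := Fintype.mem_piFinset.1 ht i
      simpa only [hPdef, Finset.mem_sigma] using this
    have hv : ∀ i, ∃ v ∈ (t i).1, M ≤ (t i).2 v * (k + 1) := fun i =>
      exists_big_coord _ M k hM (hFk _ (ht' i).1) _ (ht' i).2
    choose v hvs hvM using hv
    have hzero : ∀ i w, w ∉ (t i).1 → (t i).2 w = 0 := by
      intro i w hw
      by_contra h
      exact hw ((Finset.mem_piAntidiag.1 (ht' i).2).2 w h)
    have := count_update_multi (α := Fin n → Fin r) v (fun i => Ev z0 (t i)) Kk ?_ ?_
      (Finset.univ : Finset (Fin m))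
    · simpa [bad] using this
    · intro i j hij u w
      have hvj : v j ∉ (t i).1 := fun h =>
        (Finset.disjoint_left.1 (hdj i j hij)) h (hvs j)
      have : ∀ l, ∑ x, ((t i).2 x : ℝ) * (q x l + ((update u (v j) w) x l : ℕ) / M) =
          ∑ x, ((t i).2 x : ℝ) * (q x l + (u x l : ℕ) / M) := by
        intro l
        refine Finset.sum_congr rfl fun x _ => ?_
        by_cases hx : x = v j
        · subst hx; rw [hzero i _ hvj]; simp
        · rw [update_of_ne hx]
      simp only [Ev, this]
    · intro i u
      have hMpos : (0 : ℝ) < M := by exact_mod_cast hM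
      refine le_trans (Finset.card_le_card ?_) (count_box n r
        (fun l => ∑ x ∈ Finset.univ.erase (v i), ((t i).2 x : ℝ) * (q x l + (u x l : ℕ) / M) +
          (t i).2 (v i) * q (v i) l - z0 l) ((t i).2 (v i) / M) H k ?_)
      · intro w hw
        simp only [Finset.mem_filter, Finset.mem_univ, true_and, Ev] at hw ⊢
        intro l
        have h := hw l
        rw [← Finset.add_sum_erase _ _ (Finset.mem_univ (v i))] at h
        rw [Finset.sum_congr rfl (g := fun x => ((t i).2 x : ℝ) * (q x l + (u x l : ℕ) / M))] at h
        · convert h using 2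
          rw [update_self]; ring
        · intro x hx
          rw [update_of_ne (Finset.ne_of_mem_erase hx)]
      · rw [div_mul_eq_mul_div, le_div_iff₀ hMpos, one_mul]
        exact_mod_cast hvM i
  -- covering
  have hcov : (Finset.univ : Finset (Fin N → Fin n → Fin r)) ⊆
      ((Zs ×ˢ Ts).filter (fun x => Dj x.2)).biUnion bad := by
    intro u _
    obtain ⟨z0, hz0, t, ht, hdj, hE⟩ := hcon u
    simp only [Finset.mem_biUnion, Finset.mem_filter, Finset.mem_product]
    refine ⟨(z0, t), ⟨⟨?_, ?_⟩, hdj⟩, ?_⟩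
    · simp only [Zs, Fintype.mem_piFinset, Finset.mem_Icc]
      intro l; exact abs_le.1 (hz0 l)
    · simpa only [Ts, Fintype.mem_piFinset] using ht
    · simp only [bad, Finset.mem_filter, Finset.mem_univ, true_and, Ev]
      intro i _ l; exact hE i l
  have hcard := (Finset.card_le_card hcov).trans Finset.card_biUnion_le
  rw [Finset.card_univ] at hcard
  set Ω := Fintype.card (Fin N → Fin n → Fin r) with hΩ
  have hΩpos : 0 < Ω := by
    have : Nonempty (Fin r) := ⟨⟨0, hr⟩⟩
    exact Fintype.card_pos
  have hc2 : (r ^ n) ^ m * Ω ≤ (2 * B + 1) ^ n * Pb ^ m * (Kk ^ m * Ω) := by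
    calc (r ^ n) ^ m * Ω ≤ (r ^ n) ^ m * ∑ x ∈ (Zs ×ˢ Ts).filter (fun x => Dj x.2), (bad x).card :=
          Nat.mul_le_mul_left _ hcard
      _ = ∑ x ∈ (Zs ×ˢ Ts).filter (fun x => Dj x.2), (r ^ n) ^ m * (bad x).card := by
          rw [Finset.mul_sum]
      _ ≤ ∑ x ∈ (Zs ×ˢ Ts).filter (fun x => Dj x.2), Kk ^ m * Ω := Finset.sum_le_sum hbad
      _ = ((Zs ×ˢ Ts).filter (fun x => Dj x.2)).card * (Kk ^ m * Ω) := by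
          rw [Finset.sum_const, smul_eq_mul]
      _ ≤ _ := by
          apply Nat.mul_le_mul_right
          refine (Finset.card_filter_le _ _).trans ?_
          rw [Finset.card_product, hZ]
          exact Nat.mul_le_mul_left _ hT
  have hc3 : (2 * B + 1) ^ n * Pb ^ m * (Kk ^ m * Ω) < (r ^ n) ^ m * Ω := by
    have hpos : 0 < (Pb * Kk) ^ m * Ω := by positivity
    calc (2 * B + 1) ^ n * Pb ^ m * (Kk ^ m * Ω) = (2 * B + 1) ^ n * ((Pb * Kk) ^ m * Ω) := by
          rw [mul_pow]; ring
      _ < 2 ^ m * ((Pb * Kk) ^ m * Ω) := Nat.mul_lt_mul_of_pos_right h2 hpos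
      _ = (2 * (Pb * Kk)) ^ m * Ω := by rw [mul_pow 2]; ring
      _ ≤ (r ^ n) ^ m * Ω := Nat.mul_le_mul_right _ (Nat.pow_le_pow_left h1 m)
  omega

lemma cover_faces {ι : Type*} [DecidableEq ι] (F Hs : Finset (Finset ι)) (k L m : ℕ) (hHF : Hs ⊆ F)
    (hne : ∀ s ∈ F, s.Nonempty) (hFk : ∀ s ∈ F, s.card ≤ k + 1)
    (hL : ∀ v, (F.filter (fun s => v ∈ s)).card ≤ L)
    (hm : ¬ ∃ t : Fin m → Finset ι, (∀ i, t i ∈ Hs) ∧ ∀ i j, i ≠ j → Disjoint (t i) (t j)) :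
    Hs.card ≤ m * ((k + 1) * L) := by
  obtain ⟨G, hG, hmax⟩ := (Hs.powerset.filter
    (fun G => ∀ s ∈ G, ∀ t ∈ G, s ≠ t → Disjoint s t)).exists_max_image Finset.card
    ⟨∅, by simp⟩
  simp only [Finset.mem_filter, Finset.mem_powerset] at hG hmax
  have hGm : G.card ≤ m := by
    by_contra! h
    apply hm
    let e := G.equivFin.symm
    refine ⟨fun i => (e ⟨i, i.2.trans h⟩ : Finset ι), fun i => hG.1 (e _).2, fun i j hij => ?_⟩
    refine hG.2 _ (e _).2 _ (e _).2 fun h' => hij ?_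
    have := e.injective (Subtype.ext h')
    simpa [Fin.ext_iff] using this
  have hcov : Hs ⊆ G.biUnion (fun t => t.biUnion (fun v => F.filter (fun s => v ∈ s))) := by
    intro s hs
    have hint : ∃ t ∈ G, ¬ Disjoint s t := by
      by_contra! hcon
      have hsG : s ∉ G := fun h => by
        have := hcon s h
        rw [disjoint_self] at this
        exact (hne s (hHF hs)).ne_empty this
      have := hmax (insert s G) ⟨Finset.insert_subset hs hG.1, ?_⟩
      · rw [Finset.card_insert_of_notMem hsG] at this; omega
      · intro a ha b hb hab
        rw [Finset.mem_insert] at ha hb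
        rcases ha with rfl | ha <;> rcases hb with rfl | hb
        · exact absurd rfl hab
        · exact hcon b hb
        · exact (hcon a ha).symm
        · exact hG.2 a ha b hb hab
    obtain ⟨t, htG, hd⟩ := hint
    rw [Finset.not_disjoint_iff] at hd
    obtain ⟨v, hvs, hvt⟩ := hd
    simp only [Finset.mem_biUnion, Finset.mem_filter]
    exact ⟨t, htG, v, hvt, hHF hs, hvs⟩
  calc Hs.card ≤ _ := Finset.card_le_card hcov
    _ ≤ G.card * ((k + 1) * L) := by
        apply Finset.card_biUnion_le_card_mul
        intro t ht
        refine (Finset.card_biUnion_le_card_mul _ _ L fun v _ => hL v).trans ?_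
        exact Nat.mul_le_mul_right _ (hFk t (hHF (hG.1 ht)))
    _ ≤ _ := Nat.mul_le_mul_right _ hGm

lemma mult_bound (n k χ T C : ℕ)
    (hnd : ∀ (N : ℕ) (s : Finset (Fin N)) (col : Fin N → Fin χ), s.card ≤ k + 1 → InjOn col s →
    ∀ e : Fin N → Fin n → ℝ, (∀ v l, |e v l| ≤ 1 / T) → ∀ (τ : Fin N → ℝ) (H : ℝ), 0 ≤ H →
    (∀ l : Fin n, |∑ v ∈ s, τ v * (((col v : Fin χ) : ℝ) ^ (l : ℕ) + e v l)| ≤ H) →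
    ∀ v ∈ s, |τ v| ≤ C * H)
    (N M H : ℕ) (s : Finset (Fin N)) (col : Fin N → Fin χ) (hs : s.card ≤ k + 1)
    (hinj : InjOn col s) (e : Fin N → Fin n → ℝ) (he : ∀ v l, |e v l| ≤ 1 / T) (z0 : Fin n → ℝ) :
    ((s.piAntidiag M).filter (fun a => ∀ l : Fin n, |∑ v, (a v : ℝ) *
      (((col v : Fin χ) : ℝ) ^ (l : ℕ) + e v l) - z0 l| ≤ H)).card ≤
      (2 * (C * (2 * H)) + 1) ^ (k + 1) := by
  set A := ((s.piAntidiag M).filter (fun a => ∀ l : Fin n, |∑ v, (a v : ℝ) *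
      (((col v : Fin χ) : ℝ) ^ (l : ℕ) + e v l) - z0 l| ≤ H)) with hA
  rcases A.eq_empty_or_nonempty with h0 | ⟨a0, ha0⟩
  · simp [h0]
  have hmem : ∀ a ∈ A, (∀ v, v ∉ s → a v = 0) ∧ ∀ l : Fin n, |∑ v ∈ s, (a v : ℝ) *
      (((col v : Fin χ) : ℝ) ^ (l : ℕ) + e v l) - z0 l| ≤ H := by
    intro a ha
    rw [hA, Finset.mem_filter, Finset.mem_piAntidiag] at ha
    have hz : ∀ v, v ∉ s → a v = 0 := fun v hv => by
      by_contra h; exact hv (ha.1.2 v h)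
    refine ⟨hz, fun l => ?_⟩
    rw [Finset.sum_subset (Finset.subset_univ s)]
    · exact ha.2 l
    · intro v _ hv; rw [hz v hv]; simp
  have hclose : ∀ a ∈ A, ∀ v ∈ s, |(a v : ℝ) - a0 v| ≤ C * (2 * H) := by
    intro a ha
    apply hnd N s col hs hinj e he (fun v => (a v : ℝ) - a0 v) (2 * H) (by positivity)
    intro l
    have h1 := (hmem a ha).2 l
    have h2 := (hmem a0 ha0).2 l
    simp only [sub_mul, Finset.sum_sub_distrib]
    rw [abs_le] at h1 h2 ⊢
    constructor <;> linarith [h1.1, h1.2, h2.1, h2.2]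
  have : A.card ≤ (Fintype.piFinset (fun v : {v // v ∈ s} =>
      Finset.Icc (a0 v - C * (2 * H)) (a0 v + C * (2 * H)))).card := by
    apply Finset.card_le_card_of_injOn (fun a (v : {v // v ∈ s}) => a v)
    · intro a ha
      simp only [Finset.mem_coe, Fintype.mem_piFinset, Finset.mem_Icc]
      intro v
      have h := abs_le.1 (hclose a ha v v.2)
      have h3 : ((a0 v : ℕ) : ℝ) ≤ ((a v + C * (2 * H) : ℕ) : ℝ) := by push_cast; linarith [h.1]
      have h4 : ((a v : ℕ) : ℝ) ≤ ((a0 v + C * (2 * H) : ℕ) : ℝ) := by push_cast; linarith [h.2]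
      have h3' : a0 v ≤ a v + C * (2 * H) := by exact_mod_cast h3
      have h4' : a v ≤ a0 v + C * (2 * H) := by exact_mod_cast h4
      omega
    · intro a ha b hb hab
      funext v
      by_cases hv : v ∈ s
      · exact congrFun hab ⟨v, hv⟩
      · rw [(hmem a ha).1 v hv, (hmem b hb).1 v hv]
  refine this.trans ?_
  rw [Fintype.card_piFinset]
  refine (Finset.prod_le_pow_card _ _ (2 * (C * (2 * H)) + 1) (fun v _ => ?_)).trans ?_
  · rw [Nat.card_Icc]; omega
  · apply Nat.pow_le_pow_right (by omega)
    simpa using hs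


lemma log_bound (C3 N X : ℕ) (hN : 2 ≤ N) (hX : X ≤ C3 * N) :
    ((Nat.log 2 X + 1 : ℕ) : ℝ) ≤ 2 * (C3 + 2) * Real.log N := by
  have hln2 : (1 / 2 : ℝ) ≤ Real.log 2 := by linarith [Real.log_two_gt_d9]
  have hNr : (2 : ℝ) ≤ N := by exact_mod_cast hN
  have hlN : Real.log 2 ≤ Real.log N := Real.log_le_log (by norm_num) hNr
  have h1 : C3 * N ≤ N ^ (C3 + 1) := by
    rw [pow_succ]
    apply Nat.mul_le_mul_right
    exact (Nat.lt_pow_self (by omega)).le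
  have h2 : 2 ^ Nat.log 2 X ≤ N ^ (C3 + 1) := by
    by_cases h0 : X = 0
    · subst h0; simp; exact Nat.one_le_pow _ _ (by omega)
    · exact (Nat.pow_log_le_self 2 h0).trans (hX.trans h1)
  have h3 : (2 : ℝ) ^ Nat.log 2 X ≤ (N : ℝ) ^ (C3 + 1) := by exact_mod_cast h2
  have h4 := Real.log_le_log (by positivity) h3
  rw [Real.log_pow, Real.log_pow] at h4
  push_cast at h4 ⊢
  have h5 : (0 : ℝ) ≤ Nat.log 2 X := by positivity
  nlinarith

set_option maxHeartbeats 2000000 in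
lemma stage1 (k n L : ℕ) (hn : 2 * k + 1 ≤ n) : ∃ Q : ℕ, ∀ K : ℕ, ∃ C : ℕ,
    ∀ (N : ℕ) (_ : 2 ≤ N) (F : Finset (Finset (Fin N))) (_ : ∀ s ∈ F, s.Nonempty)
      (_ : ∀ s ∈ F, s.card ≤ k + 1) (_ : ∀ v, (F.filter (fun s => v ∈ s)).card ≤ L),
    ∃ (M D : ℕ) (p : Fin N → Fin n → ℝ), 1 ≤ M ∧
      (M : ℝ) ≤ C * (N : ℝ) ^ (((n : ℝ) - (k : ℝ))⁻¹) ∧ (D : ℝ) ≤ C * Real.log N ∧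
      (∀ v l, |p v l| ≤ Q) ∧
      ∀ z0 : Fin n → ℤ, ((F.biUnion (fun s => s.piAntidiag M)).filter
        (fun a => ∀ l : Fin n, |⌊∑ v, (a v : ℝ) * p v l⌋ - z0 l| ≤ (K : ℤ))).card ≤ D := by
  set χ := L * (k + 1) + 1 with hχ
  obtain ⟨T, C0, hT, hnd⟩ := nondeg n k χ (by omega)
  refine ⟨χ ^ n + 1, fun K => ?_⟩
  set Q := χ ^ n + 1 with hQ
  set H := K + 1 with hH
  set Kk := (2 * H * (k + 1) + 1) ^ n with hKk
  set C1 := 2 * Kk * (L + 1) * (2 * T) ^ k with hC1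
  have hKk1 : 1 ≤ Kk := Nat.one_le_pow _ _ (by omega)
  have hC1pos : 1 ≤ C1 := by
    have : 1 ≤ (2 * T) ^ k := Nat.one_le_pow _ _ (by omega)
    have h2 : 1 ≤ 2 * Kk * (L + 1) := Nat.mul_pos (by omega) (by omega)
    exact Nat.mul_pos h2 this
  set C3 := (2 * (T * Q + K + 1) + 1) * (2 * C1) with hC3
  set R := ((k + 1) * L) * (2 * (C0 * (2 * H)) + 1) ^ (k + 1) with hR
  refine ⟨T * (2 * C1) + n * (2 * (C3 + 2)) * R, ?_⟩
  intro N hN F hne hFk hL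
  have hNr : (2 : ℝ) ≤ N := by exact_mod_cast hN
  set α : ℝ := ((n : ℝ) - (k : ℝ))⁻¹ with hα
  have hnk : (1 : ℝ) ≤ (n : ℝ) - k := by
    have : ((2 * k + 1 : ℕ) : ℝ) ≤ n := by exact_mod_cast hn
    push_cast at this
    have : (0 : ℝ) ≤ k := by positivity
    linarith
  have hα0 : 0 < α := inv_pos.2 (by linarith)
  have hα1 : α ≤ 1 := inv_le_one_of_one_le₀ hnk
  set x : ℝ := ((C1 : ℝ) * N) ^ α with hx
  have hC1r : (1 : ℝ) ≤ C1 := by exact_mod_cast hC1pos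
  have hx1 : 1 ≤ x := Real.one_le_rpow (by nlinarith) hα0.le
  have hNα : (N : ℝ) ^ α ≤ N := by
    calc (N : ℝ) ^ α ≤ (N : ℝ) ^ (1 : ℝ) := Real.rpow_le_rpow_of_exponent_le (by linarith) hα1
      _ = N := Real.rpow_one _
  have hNα0 : 0 ≤ (N : ℝ) ^ α := by positivity
  have hx2 : x ≤ C1 * (N : ℝ) ^ α := by
    rw [hx, Real.mul_rpow (by positivity) (by positivity)]
    apply mul_le_mul_of_nonneg_right _ hNα0
    calc (C1 : ℝ) ^ α ≤ (C1 : ℝ) ^ (1 : ℝ) := Real.rpow_le_rpow_of_exponent_le hC1r hα1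
      _ = C1 := Real.rpow_one _
  set r := ⌈x⌉₊ with hr
  have hrx : x ≤ r := Nat.le_ceil x
  have hr1 : 1 ≤ r := by
    have : (1 : ℝ) ≤ r := hx1.trans hrx
    exact_mod_cast this
  have hr2 : (r : ℝ) ≤ 2 * C1 * (N : ℝ) ^ α := by
    have := Nat.ceil_lt_add_one (by linarith : 0 ≤ x)
    linarith
  have hrpow : C1 * N ≤ r ^ (n - k) := by
    have h1 : x ^ (n - k) = (C1 : ℝ) * N := by
      rw [hx, ← Real.rpow_natCast, ← Real.rpow_mul (by positivity)]
      rw [Nat.cast_sub (by omega), hα, inv_mul_cancel₀ (by linarith), Real.rpow_one]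
    have h2 : (C1 : ℝ) * N ≤ (r : ℝ) ^ (n - k) := by
      rw [← h1]; exact pow_le_pow_left₀ (by linarith) hrx _
    exact_mod_cast h2
  have hrN : r ≤ 2 * C1 * N := by
    have : (r : ℝ) ≤ 2 * C1 * N := hr2.trans (mul_le_mul_of_nonneg_left hNα (by positivity))
    exact_mod_cast this
  set M := T * r with hM
  have hM1 : 1 ≤ M := Nat.mul_pos hT hr1
  set B := M * Q + K + 1 with hB
  set m := n * (Nat.log 2 (2 * B + 1) + 1) with hm
  set D := m * R with hD
  clear_value D m B M
  clear_value r
  clear_value x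
  clear_value R C3
  clear_value C1
  clear_value Kk
  clear_value H
  -- vertex colouring
  obtain ⟨col, hcol⟩ := greedy_color (Finset.univ : Finset (Fin N))
    (fun v w => ∃ s ∈ F, v ∈ s ∧ w ∈ s) (fun a b ⟨s, hs, ha, hb⟩ => ⟨s, hs, hb, ha⟩) (L * (k + 1))
    (by
      intro a _
      have : (Finset.univ.filter (fun b => ∃ s ∈ F, a ∈ s ∧ b ∈ s)) ⊆
          (F.filter (fun s => a ∈ s)).biUnion id := by
        intro b hb
        simp only [Finset.mem_filter, Finset.mem_univ, true_and] at hb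
        obtain ⟨s, hs, ha, hb⟩ := hb
        simp only [Finset.mem_biUnion, Finset.mem_filter, id]
        exact ⟨s, ⟨hs, ha⟩, hb⟩
      have h2 : (Finset.univ.filter (fun b => ∃ s ∈ F, a ∈ s ∧ b ∈ s)).card ≤ L * (k + 1) := by
        refine (Finset.card_le_card this).trans ?_
        refine (Finset.card_biUnion_le_card_mul _ _ (k + 1) ?_).trans
          (Nat.mul_le_mul_right _ (hL a))
        intro s hs
        exact hFk s (Finset.mem_filter.1 hs).1
      convert h2)
  have hinj : ∀ s ∈ F, InjOn col s := by
    intro s hs a ha b hb hab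
    by_contra hne'
    exact hcol a (Finset.mem_univ _) b (Finset.mem_univ _) hne' ⟨s, hs, ha, hb⟩ hab
  let q : Fin N → Fin n → ℝ := fun v l => ((col v : Fin χ) : ℝ) ^ (l : ℕ)
  -- count of pairs
  have hFcard : F.card ≤ N * L := by
    have : F ⊆ (Finset.univ : Finset (Fin N)).biUnion (fun v => F.filter (fun s => v ∈ s)) := by
      intro s hs
      obtain ⟨v, hv⟩ := hne s hs
      simp only [Finset.mem_biUnion, Finset.mem_filter, Finset.mem_univ, true_and]
      exact ⟨v, hs, hv⟩
    refine (Finset.card_le_card this).trans ?_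
    refine (Finset.card_biUnion_le_card_mul _ _ L (fun v _ => hL v)).trans ?_
    simp
  set Pb := N * (L + 1) * (2 * T) ^ k * r ^ k with hPb
  have hPb1 : 1 ≤ Pb := by
    have h1 : 1 ≤ (2 * T) ^ k := Nat.one_le_pow _ _ (by omega)
    have h2 : 1 ≤ r ^ k := Nat.one_le_pow _ _ (by omega)
    have h3 : 1 ≤ N * (L + 1) := Nat.mul_pos (by omega) (by omega)
    exact Nat.mul_pos (Nat.mul_pos h3 h1) h2
  have hPcard : (F.sigma (fun s => s.piAntidiag M)).card ≤ Pb := by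
    rw [Finset.card_sigma]
    calc ∑ s ∈ F, (s.piAntidiag M).card ≤ ∑ s ∈ F, (M + 1) ^ k :=
          Finset.sum_le_sum fun s hs => card_piAntidiag_le s M k (hFk s hs)
      _ = F.card * (M + 1) ^ k := by rw [Finset.sum_const, smul_eq_mul]
      _ ≤ (N * (L + 1)) * ((2 * T) ^ k * r ^ k) := by
          apply Nat.mul_le_mul
          · exact hFcard.trans (Nat.mul_le_mul_left _ (by omega))
          · rw [← mul_pow]
            apply Nat.pow_le_pow_left
            rw [mul_assoc]; omega
      _ = Pb := by rw [hPb]; ring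
  have hcond : 2 * (Pb * (2 * H * (k + 1) + 1) ^ n) ≤ r ^ n := by
    rw [← hKk]
    calc 2 * (Pb * Kk) = (C1 * N) * r ^ k := by rw [hPb, hC1]; ring
      _ ≤ r ^ (n - k) * r ^ k := Nat.mul_le_mul_right _ hrpow
      _ = r ^ n := by rw [← pow_add]; congr 1; omega
  have hcondm : (2 * B + 1) ^ n < 2 ^ m := by
    rw [hm, mul_comm n, pow_mul]
    exact Nat.pow_lt_pow_left (Nat.lt_pow_succ_log_self (by norm_num) _) (by omega)
  obtain ⟨u, hu⟩ := stage1_random k n N r M m H B Pb hr1 hM1 F hFk q hPb1 hPcard hcond hcondm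
  let e : Fin N → Fin n → ℝ := fun v l => ((u v l : ℕ) : ℝ) / M
  have hTr : (1 : ℝ) ≤ T := by exact_mod_cast hT
  have hrr : (1 : ℝ) ≤ r := by exact_mod_cast hr1
  have he : ∀ v l, |e v l| ≤ 1 / T := by
    intro v l
    have hlt : ((u v l : ℕ) : ℝ) ≤ r := by exact_mod_cast (u v l).2.le
    rw [abs_of_nonneg (by positivity)]
    simp only [e, hM]
    push_cast
    rw [div_le_div_iff₀ (by positivity) (by positivity)]
    nlinarith
  have hpQ : ∀ v l, |q v l + e v l| ≤ Q := by
    intro v l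
    have h1 : |q v l| ≤ (χ : ℝ) ^ n := by
      have hχ1 : (1 : ℝ) ≤ χ := by rw [hχ]; push_cast; nlinarith [(by positivity : (0:ℝ) ≤ L * (k+1))]
      rw [abs_of_nonneg (by positivity)]
      have : (((col v : Fin χ) : ℕ) : ℝ) ≤ χ := by exact_mod_cast (col v).2.le
      calc q v l ≤ (χ : ℝ) ^ (l : ℕ) := pow_le_pow_left₀ (by positivity) this _
        _ ≤ (χ : ℝ) ^ n := pow_le_pow_right₀ hχ1 l.2.le
    have h2 : |e v l| ≤ 1 := (he v l).trans (by rw [div_le_one (by linarith)]; exact hTr)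
    calc |q v l + e v l| ≤ |q v l| + |e v l| := abs_add_le _ _
      _ ≤ (χ : ℝ) ^ n + 1 := add_le_add h1 h2
      _ = Q := by rw [hQ]; push_cast; ring
  refine ⟨M, D, fun v l => q v l + e v l, hM1, ?_, ?_, hpQ, ?_⟩
  · rw [hM]; push_cast
    calc (T : ℝ) * r ≤ T * (2 * C1 * (N : ℝ) ^ α) := mul_le_mul_of_nonneg_left hr2 (by positivity)
      _ = T * (2 * C1) * (N : ℝ) ^ α := by ring
      _ ≤ _ := mul_le_mul_of_nonneg_right (le_add_of_nonneg_right (by positivity)) hNα0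
  · have hXb : 2 * B + 1 ≤ C3 * N := by
      have h0 : M * Q + K + 1 ≤ (T * Q + K + 1) * r := by
        rw [hM]; nlinarith [Nat.mul_le_mul_left (K + 1) hr1]
      calc 2 * B + 1 ≤ (2 * (T * Q + K + 1) + 1) * r := by rw [hB]; nlinarith
        _ ≤ (2 * (T * Q + K + 1) + 1) * (2 * C1 * N) := Nat.mul_le_mul_left _ hrN
        _ = C3 * N := by rw [hC3]; ring
    have hlb := log_bound C3 N (2 * B + 1) hN hXb
    have hlog : 0 ≤ Real.log N := Real.log_nonneg (by linarith)
    rw [hD, hm]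
    rw [Nat.cast_mul, Nat.cast_mul]
    calc (n : ℝ) * ((Nat.log 2 (2 * B + 1) + 1 : ℕ) : ℝ) * R ≤
        (n : ℝ) * (2 * (C3 + 2) * Real.log N) * R :=
          mul_le_mul_of_nonneg_right (mul_le_mul_of_nonneg_left hlb (by positivity)) (by positivity)
      _ = (n * (2 * (C3 + 2)) * R) * Real.log N := by ring
      _ ≤ _ := by
          apply mul_le_mul_of_nonneg_right _ hlog
          push_cast
          exact le_add_of_nonneg_left (by positivity)
  · intro z0
    by_cases hz0 : ∀ l, |z0 l| ≤ B
    · -- generic bound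
      let Hs := F.filter (fun s => ∃ a ∈ s.piAntidiag M, ∀ l : Fin n,
        |∑ v, (a v : ℝ) * (q v l + e v l) - z0 l| ≤ H)
      have hHs : Hs.card ≤ m * ((k + 1) * L) := by
        refine cover_faces F Hs k L m (Finset.filter_subset _ _) hne hFk hL ?_
        rintro ⟨t, ht, hdj⟩
        apply hu z0 hz0
        have : ∀ i, ∃ a ∈ (t i).piAntidiag M, ∀ l : Fin n,
            |∑ v, (a v : ℝ) * (q v l + e v l) - z0 l| ≤ H := fun i =>
          (Finset.mem_filter.1 (ht i)).2
        choose a ha hal using this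
        refine ⟨fun i => ⟨t i, a i⟩, fun i => ?_, hdj, hal⟩
        exact Finset.mem_sigma.2 ⟨(Finset.mem_filter.1 (ht i)).1, ha i⟩
      have hcov : ((F.biUnion (fun s => s.piAntidiag M)).filter
          (fun a => ∀ l : Fin n, |⌊∑ v, (a v : ℝ) * (q v l + e v l)⌋ - z0 l| ≤ (K : ℤ))) ⊆
          Hs.biUnion (fun s => (s.piAntidiag M).filter (fun a => ∀ l : Fin n, |∑ v, (a v : ℝ) *
            (q v l + e v l) - (z0 l : ℝ)| ≤ H)) := by
        intro a ha
        simp only [Finset.mem_filter, Finset.mem_biUnion] at ha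
        obtain ⟨⟨s, hs, has⟩, hal⟩ := ha
        have hal' : ∀ l : Fin n, |∑ v, (a v : ℝ) * (q v l + e v l) - z0 l| ≤ H := by
          intro l
          have h := abs_le.1 (hal l)
          have h1 := Int.floor_le (∑ v, (a v : ℝ) * (q v l + e v l))
          have h2 := Int.lt_floor_add_one (∑ v, (a v : ℝ) * (q v l + e v l))
          have h3 : (-(K : ℝ)) ≤ (⌊∑ v, (a v : ℝ) * (q v l + e v l)⌋ : ℝ) - z0 l := by
            exact_mod_cast h.1
          have h4 : (⌊∑ v, (a v : ℝ) * (q v l + e v l)⌋ : ℝ) - z0 l ≤ K := by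
            exact_mod_cast h.2
          rw [abs_le, hH]; push_cast
          constructor <;> linarith
        simp only [Finset.mem_biUnion, Finset.mem_filter]
        exact ⟨s, Finset.mem_filter.2 ⟨hs, a, has, hal'⟩, has, hal'⟩
      refine (Finset.card_le_card hcov).trans ?_
      refine (Finset.card_biUnion_le_card_mul _ _ ((2 * (C0 * (2 * H)) + 1) ^ (k + 1)) ?_).trans ?_
      · intro s hs
        have hsF := (Finset.mem_filter.1 hs).1
        exact mult_bound n k χ T C0 hnd N M H s col (hFk s hsF) (hinj s hsF) e he (fun l => (z0 l : ℝ))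
      · have h := Nat.mul_le_mul_right ((2 * (C0 * (2 * H)) + 1) ^ (k + 1)) hHs
        rw [mul_assoc m] at h
        rw [hD, hR]
        exact h
    · -- empty
      rw [Finset.card_eq_zero.2]
      · omega
      rw [Finset.filter_eq_empty_iff]
      intro a ha hal
      apply hz0
      intro l
      obtain ⟨s, hs, has⟩ := Finset.mem_biUnion.1 ha
      rw [Finset.mem_piAntidiag] at has
      have hsum : ∑ v, (a v : ℝ) = M := by
        rw [← Finset.sum_subset (Finset.subset_univ s)]
        · exact_mod_cast has.1
        · intro v _ hv
          have : a v = 0 := by by_contra h; exact hv (has.2 v h)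
          rw [this]; simp
      have hbd : |∑ v, (a v : ℝ) * (q v l + e v l)| ≤ M * Q := by
        calc _ ≤ ∑ v, |(a v : ℝ) * (q v l + e v l)| := Finset.abs_sum_le_sum_abs _ _
          _ ≤ ∑ v, (a v : ℝ) * Q := Finset.sum_le_sum fun v _ => by
              rw [abs_mul, abs_of_nonneg (by positivity : (0 : ℝ) ≤ a v)]
              exact mul_le_mul_of_nonneg_left (hpQ v l) (by positivity)
          _ = _ := by rw [← Finset.sum_mul, hsum]
      have h := abs_le.1 (hal l)
      have h1 := Int.floor_le (∑ v, (a v : ℝ) * (q v l + e v l))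
      have h2 := Int.lt_floor_add_one (∑ v, (a v : ℝ) * (q v l + e v l))
      have h3 : (-(K : ℝ)) ≤ (⌊∑ v, (a v : ℝ) * (q v l + e v l)⌋ : ℝ) - z0 l := by
        exact_mod_cast h.1
      have h4 : (⌊∑ v, (a v : ℝ) * (q v l + e v l)⌋ : ℝ) - z0 l ≤ K := by
        exact_mod_cast h.2
      have h5 := abs_le.1 hbd
      have h6 : |(z0 l : ℝ)| ≤ ((B : ℕ) : ℝ) := by
        rw [abs_le, hB]; push_cast
        constructor <;> linarith [h5.1, h5.2]
      exact_mod_cast h6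


noncomputable def pS {N : ℕ} (x : Fin N → ℝ) (j : ℕ) : ℝ := ∑ i : Fin N, if (i : ℕ) < j then x i else 0

noncomputable def pA {N : ℕ} (M : ℕ) (x : Fin N → ℝ) (θ : ℝ) (j : ℕ) : ℤ := ⌊(M : ℝ) * pS x j + θ⌋

noncomputable def corner {N : ℕ} (M : ℕ) (x : Fin N → ℝ) (θ : ℝ) (i : Fin N) : ℕ :=
  (pA M x θ (i + 1) - pA M x θ i).toNat

lemma pS_succ {N : ℕ} (x : Fin N → ℝ) (i : Fin N) : pS x (i + 1) = pS x i + x i := by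
  have : x i = ∑ j : Fin N, if j = i then x j else 0 := by simp
  unfold pS
  rw [this, ← Finset.sum_add_distrib]
  apply Finset.sum_congr rfl
  intro j _
  by_cases h : j = i
  · subst h; simp
  · have h' : (j : ℕ) ≠ i := fun h' => h (Fin.ext h')
    have : ((j : ℕ) < i + 1) ↔ ((j : ℕ) < i) := by omega
    simp [h, this]

lemma pS_zero {N : ℕ} (x : Fin N → ℝ) : pS x 0 = 0 := by simp [pS]

lemma pS_top {N : ℕ} (x : Fin N → ℝ) : pS x N = ∑ i, x i := by simp [pS]

lemma pA_mono_succ {N : ℕ} (M : ℕ) (x : Fin N → ℝ) (hx : ∀ i, 0 ≤ x i) (θ : ℝ) (i : Fin N) :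
    pA M x θ i ≤ pA M x θ (i + 1) := by
  unfold pA
  apply Int.floor_le_floor
  rw [pS_succ]
  have := mul_nonneg (Nat.cast_nonneg (α := ℝ) M) (hx i)
  linarith

lemma corner_cast {N : ℕ} (M : ℕ) (x : Fin N → ℝ) (hx : ∀ i, 0 ≤ x i) (θ : ℝ) (i : Fin N) :
    ((corner M x θ i : ℕ) : ℤ) = pA M x θ (i + 1) - pA M x θ i := by
  unfold corner
  rw [Int.toNat_of_nonneg]
  linarith [pA_mono_succ M x hx θ i]

lemma corner_approx {N : ℕ} (M : ℕ) (x : Fin N → ℝ) (hx : ∀ i, 0 ≤ x i) (θ : ℝ) (i : Fin N) :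
    |(corner M x θ i : ℝ) - M * x i| ≤ 1 := by
  have h : ((corner M x θ i : ℕ) : ℝ) = (pA M x θ (i + 1) : ℝ) - pA M x θ i := by
    have := corner_cast M x hx θ i
    exact_mod_cast this
  rw [h]
  unfold pA
  rw [pS_succ, mul_add]
  have h1 := Int.floor_le ((M : ℝ) * pS x i + M * x i + θ)
  have h2 := Int.lt_floor_add_one ((M : ℝ) * pS x i + M * x i + θ)
  have h3 := Int.floor_le ((M : ℝ) * pS x i + θ)
  have h4 := Int.lt_floor_add_one ((M : ℝ) * pS x i + θ)
  rw [abs_le]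
  constructor <;> linarith

lemma pA_zero {N : ℕ} (M : ℕ) (x : Fin N → ℝ) (θ : ℝ) : pA M x θ 0 = ⌊θ⌋ := by
  simp [pA, pS_zero]

lemma corner_mem {N : ℕ} (M : ℕ) (x : Fin N → ℝ) (hx : ∀ i, 0 ≤ x i) (hx1 : ∑ i, x i = 1) (θ : ℝ)
    (s : Finset (Fin N)) (hs : ∀ i, i ∉ s → x i = 0) : corner M x θ ∈ s.piAntidiag M := by
  have h0 : ∀ i, i ∉ s → corner M x θ i = 0 := by
    intro i hi
    unfold corner pA
    rw [pS_succ, hs i hi]; simp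
  rw [Finset.mem_piAntidiag]
  constructor
  · rw [Finset.sum_subset (Finset.subset_univ s) (fun i _ hi => h0 i hi)]
    have : (∑ i, (corner M x θ i : ℤ)) = M := by
      simp_rw [corner_cast M x hx θ]
      rw [Fin.sum_univ_eq_sum_range (fun j => pA M x θ (j + 1) - pA M x θ j) N,
        Finset.sum_range_sub (pA M x θ)]
      rw [pA_zero]
      unfold pA
      rw [pS_top, hx1]
      simp
    exact_mod_cast this
  · intro i hi
    by_contra h
    exact hi (h0 i h)

lemma corner_finite {N : ℕ} (k M : ℕ) (x : Fin N → ℝ) (hx1 : ∑ i, x i = 1)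
    (s : Finset (Fin N)) (hs : ∀ i, i ∉ s → x i = 0) (hsk : s.card ≤ k + 1) :
    ∃ c : Fin (k + 1) → Fin N → ℕ, (∀ t, ∃ θ ∈ Ico (0 : ℝ) 1, c t = corner M x θ) ∧
      ∀ θ ∈ Ico (0 : ℝ) 1, ∃ t, corner M x θ = c t := by
  have hne : s.Nonempty := by
    by_contra h
    rw [Finset.not_nonempty_iff_eq_empty] at h
    subst h
    rw [Finset.sum_eq_zero (fun i _ => hs i (by simp))] at hx1
    norm_num at hx1
  let i0 := s.max' hne
  have hi0 : i0 ∈ s := s.max'_mem hne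
  have htop : pS x (i0 + 1) = 1 := by
    rw [← hx1]
    unfold pS
    apply Finset.sum_congr rfl
    intro i _
    split_ifs with h
    · rfl
    · symm; apply hs; intro hi
      have := s.le_max' i hi
      have : (i : ℕ) ≤ i0 := this
      omega
  let h : ℝ → ℤ := fun θ => ∑ i ∈ s, pA M x θ (i + 1)
  have pmono : ∀ θ θ', θ ≤ θ' → ∀ j, pA M x θ j ≤ pA M x θ' j := fun θ θ' hθ j =>
    Int.floor_le_floor (by linarith)
  have hrange : ∀ θ ∈ Ico (0 : ℝ) 1, h 0 ≤ h θ ∧ h θ ≤ h 0 + k := by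
    intro θ hθ
    constructor
    · exact Finset.sum_le_sum fun i _ => pmono 0 θ hθ.1 _
    · have e0 : ∀ θ ∈ Ico (0 : ℝ) 1, pA M x θ (i0 + 1) = M := by
        intro θ hθ
        unfold pA
        rw [htop, Int.floor_eq_iff]
        push_cast
        constructor <;> linarith [hθ.1, hθ.2]
      have e1 : ∑ i ∈ s.erase i0, pA M x θ (i + 1) ≤ ∑ i ∈ s.erase i0, (pA M x 0 (i + 1) + 1) := by
        apply Finset.sum_le_sum
        intro i _
        unfold pA
        rw [← Int.floor_add_one]
        apply Int.floor_le_floor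
        linarith [hθ.2]
      have e2 : ((s.erase i0).card : ℤ) ≤ k := by
        rw [Finset.card_erase_of_mem hi0]; omega
      rw [Finset.sum_add_distrib] at e1
      simp only [Finset.sum_const, smul_eq_mul, nsmul_eq_mul, mul_one] at e1
      change ∑ i ∈ s, pA M x θ (i + 1) ≤ ∑ i ∈ s, pA M x 0 (i + 1) + k
      rw [← Finset.add_sum_erase s _ hi0, ← Finset.add_sum_erase s (fun i => pA M x 0 (i + 1)) hi0,
        e0 θ hθ, e0 0 ⟨le_rfl, zero_lt_one⟩]
      linarith
  have heq : ∀ θ ∈ Ico (0 : ℝ) 1, ∀ θ' ∈ Ico (0 : ℝ) 1, θ ≤ θ' → h θ = h θ' →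
      corner M x θ = corner M x θ' := by
    intro θ hθ θ' hθ' hle hh
    have h1 : ∀ i ∈ s, pA M x θ (i + 1) = pA M x θ' (i + 1) :=
      (Finset.sum_eq_sum_iff_of_le (f := fun i : Fin N => pA M x θ (i + 1))
        (g := fun i : Fin N => pA M x θ' (i + 1)) fun i _ => pmono θ θ' hle (i + 1)).1 hh
    have h2 : ∀ j, j ≤ N → pA M x θ j = pA M x θ' j := by
      intro j
      induction j with
      | zero =>
        intro _
        rw [pA_zero, pA_zero, Int.floor_eq_zero_iff.2 hθ, Int.floor_eq_zero_iff.2 hθ']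
      | succ j ih =>
        intro hj
        by_cases hjs : (⟨j, hj⟩ : Fin N) ∈ s
        · exact h1 _ hjs
        · have := pS_succ x ⟨j, hj⟩
          rw [hs _ hjs, add_zero] at this
          simp only at this
          have ih := ih (by omega)
          unfold pA at ih ⊢
          rw [this]; exact ih
    funext i
    unfold corner
    rw [h2 (i + 1) i.2, h2 i i.2.le]
  have heq' : ∀ θ ∈ Ico (0 : ℝ) 1, ∀ θ' ∈ Ico (0 : ℝ) 1, h θ = h θ' →
      corner M x θ = corner M x θ' := by
    intro θ hθ θ' hθ' hh
    rcases le_total θ θ' with hl | hl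
    · exact heq θ hθ θ' hθ' hl hh
    · exact (heq θ' hθ' θ hθ hl hh.symm).symm
  have hch : ∀ t : Fin (k + 1), ∃ θ ∈ Ico (0 : ℝ) 1,
      (∃ θ' ∈ Ico (0 : ℝ) 1, h θ' = h 0 + (t : ℕ)) → h θ = h 0 + (t : ℕ) := by
    intro t
    by_cases hex : ∃ θ' ∈ Ico (0 : ℝ) 1, h θ' = h 0 + (t : ℕ)
    · obtain ⟨θ', h1, h2⟩ := hex
      exact ⟨θ', h1, fun _ => h2⟩
    · exact ⟨0, ⟨le_rfl, zero_lt_one⟩, fun h => absurd h hex⟩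
  choose θs hθs hθs2 using hch
  refine ⟨fun t => corner M x (θs t), fun t => ⟨θs t, hθs t, rfl⟩, fun θ hθ => ?_⟩
  obtain ⟨r1, r2⟩ := hrange θ hθ
  have hlt : (h θ - h 0).toNat < k + 1 := by omega
  refine ⟨⟨(h θ - h 0).toNat, hlt⟩, ?_⟩
  have hv : h θ = h 0 + (((⟨(h θ - h 0).toNat, hlt⟩ : Fin (k + 1)) : ℕ) : ℤ) := by
    simp only; omega
  apply heq' θ hθ _ (hθs _)
  rw [hθs2 _ ⟨θ, hθ, hv⟩]
  exact hv

noncomputable def pg {N n : ℕ} (M : ℕ) (W : (Fin N → ℕ) → Fin n → ℝ) (x : Fin N → ℝ) : Fin n → ℝ :=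
  ∫ θ in Ico (0 : ℝ) 1, W (corner M x θ)

lemma corner_meas {N : ℕ} (M : ℕ) (x : Fin N → ℝ) : Measurable (corner M x) := by
  apply measurable_pi_lambda
  intro i
  unfold corner pA
  have h1 : ∀ c : ℝ, Measurable (fun θ : ℝ => ⌊c + θ⌋) := fun c =>
    Int.measurable_floor.comp (measurable_const_add c)
  exact (measurable_from_top (f := Int.toNat)).comp ((h1 _).sub (h1 _))

lemma pg_integrable {N n : ℕ} (M : ℕ) (W : (Fin N → ℕ) → Fin n → ℝ) (B : ℝ) (hB : ∀ a, ‖W a‖ ≤ B)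
    (x : Fin N → ℝ) :
    MeasureTheory.IntegrableOn (fun θ => W (corner M x θ)) (Ico (0 : ℝ) 1) := by
  have hm : Measurable (fun θ => W (corner M x θ)) :=
    (measurable_of_countable W).comp (corner_meas M x)
  apply MeasureTheory.Measure.integrableOn_of_bounded (M := B)
  · simp
  · exact hm.aestronglyMeasurable
  · exact Filter.Eventually.of_forall fun θ => hB _

lemma pg_mem {N n : ℕ} (k M : ℕ) (W : (Fin N → ℕ) → Fin n → ℝ) (B : ℝ) (hB : ∀ a, ‖W a‖ ≤ B)
    (x : Fin N → ℝ) (c : Fin (k + 1) → Fin N → ℕ)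
    (hc : ∀ θ ∈ Ico (0 : ℝ) 1, ∃ t, corner M x θ = c t) :
    pg M W x ∈ convexHull ℝ (range fun t => W (c t)) := by
  have : MeasureTheory.IsProbabilityMeasure (MeasureTheory.volume.restrict (Ico (0 : ℝ) 1)) := by
    constructor; simp
  unfold pg
  apply Convex.integral_mem (convex_convexHull ℝ _)
  · exact (Set.finite_range _).isClosed_convexHull ℝ
  · rw [MeasureTheory.ae_restrict_iff' measurableSet_Ico]
    refine Filter.Eventually.of_forall fun θ hθ => subset_convexHull ℝ _ ?_
    obtain ⟨t, ht⟩ := hc θ hθ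
    exact ⟨t, by simp only [ht]⟩
  · exact pg_integrable M W B hB x

lemma floor_int (s s' : ℝ) (h : s' ≤ s) :
    MeasureTheory.IntegrableOn (fun θ : ℝ => |((⌊s + θ⌋ : ℤ) : ℝ) - (⌊s' + θ⌋ : ℤ)|) (Ico (0 : ℝ) 1) ∧
    ∫ θ in Ico (0 : ℝ) 1, |((⌊s + θ⌋ : ℤ) : ℝ) - (⌊s' + θ⌋ : ℤ)| = s - s' := by
  have hfi : ∀ s : ℝ, MeasureTheory.IntegrableOn (fun θ : ℝ => Int.fract (s + θ)) (Ico (0 : ℝ) 1) := by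
    intro s
    apply MeasureTheory.Measure.integrableOn_of_bounded (M := 1)
    · simp
    · exact (measurable_fract.comp (measurable_const_add s)).aestronglyMeasurable
    · refine Filter.Eventually.of_forall fun θ => ?_
      rw [Real.norm_eq_abs, abs_of_nonneg (Int.fract_nonneg _)]
      exact (Int.fract_lt_one _).le
  have hfr : ∀ s : ℝ, ∫ θ in Ico (0 : ℝ) 1, Int.fract (s + θ) = ∫ θ in (0 : ℝ)..1, Int.fract θ := by
    intro s
    rw [MeasureTheory.integral_Ico_eq_integral_Ioc, ← intervalIntegral.integral_of_le zero_le_one,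
      intervalIntegral.integral_comp_add_left (fun t => Int.fract t) s]
    have hp : Function.Periodic (Int.fract : ℝ → ℝ) 1 := fun x => Int.fract_add_one x
    have := hp.intervalIntegral_add_eq s 0
    simpa using this
  have he : (fun θ : ℝ => |((⌊s + θ⌋ : ℤ) : ℝ) - (⌊s' + θ⌋ : ℤ)|) =
      fun θ => (s - s') - (Int.fract (s + θ) - Int.fract (s' + θ)) := by
    funext θ
    have hm : (⌊s' + θ⌋ : ℤ) ≤ ⌊s + θ⌋ := Int.floor_le_floor (by linarith)
    have hm' : ((⌊s' + θ⌋ : ℤ) : ℝ) ≤ (⌊s + θ⌋ : ℤ) := by exact_mod_cast hm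
    rw [abs_of_nonneg (by linarith)]
    unfold Int.fract
    ring
  have hc : MeasureTheory.IntegrableOn (fun _ : ℝ => s - s') (Ico (0 : ℝ) 1) := by
    simp
  rw [he]
  refine ⟨hc.sub ((hfi s).sub (hfi s')), ?_⟩
  have e1 := MeasureTheory.integral_sub hc ((hfi s).sub (hfi s'))
  simp only [Pi.sub_apply] at e1
  rw [e1, MeasureTheory.integral_sub (hfi s) (hfi s'), hfr, hfr]
  simp

lemma floor_int' (s s' : ℝ) :
    MeasureTheory.IntegrableOn (fun θ : ℝ => |((⌊s + θ⌋ : ℤ) : ℝ) - (⌊s' + θ⌋ : ℤ)|) (Ico (0 : ℝ) 1) ∧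
    ∫ θ in Ico (0 : ℝ) 1, |((⌊s + θ⌋ : ℤ) : ℝ) - (⌊s' + θ⌋ : ℤ)| = |s - s'| := by
  rcases le_total s' s with h | h
  · rw [abs_of_nonneg (by linarith : 0 ≤ s - s')]
    exact floor_int s s' h
  · rw [abs_sub_comm s s', abs_of_nonneg (by linarith : 0 ≤ s' - s)]
    simp_rw [abs_sub_comm (((⌊s + _⌋ : ℤ) : ℝ)) _]
    exact floor_int s' s h

lemma pg_lip {N n : ℕ} (M : ℕ) (W : (Fin N → ℕ) → Fin n → ℝ) (B : ℝ) (hB : ∀ a, ‖W a‖ ≤ B) :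
    ∃ C : NNReal, LipschitzWith C (pg M W) := by
  have hB0 : 0 ≤ B := (norm_nonneg _).trans (hB 0)
  have hS : ∀ (x y : Fin N → ℝ) j, |pS x j - pS y j| ≤ N * ‖x - y‖ := by
    intro x y j
    unfold pS
    rw [← Finset.sum_sub_distrib]
    refine (Finset.abs_sum_le_sum_abs _ _).trans ?_
    have : ∀ i ∈ (Finset.univ : Finset (Fin N)),
        |(if (i : ℕ) < j then x i else 0) - (if (i : ℕ) < j then y i else 0)| ≤ ‖x - y‖ := by
      intro i _
      split_ifs
      · exact norm_le_pi_norm (x - y) i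
      · simp
    refine (Finset.sum_le_sum this).trans ?_
    simp
  have key : ∀ x y : Fin N → ℝ, ‖pg M W x - pg M W y‖ ≤
      2 * B * ((N + 1) * (M * (N * ‖x - y‖))) := by
    intro x y
    unfold pg
    rw [← MeasureTheory.integral_sub (pg_integrable M W B hB x) (pg_integrable M W B hB y)]
    have hi : MeasureTheory.IntegrableOn (fun θ => ∑ j ∈ Finset.range (N + 1),
        |((pA M x θ j : ℤ) : ℝ) - (pA M y θ j : ℤ)|) (Ico (0 : ℝ) 1) := by
      apply MeasureTheory.integrable_finsetSum
      intro j _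
      exact (floor_int' _ _).1
    refine (MeasureTheory.norm_integral_le_of_norm_le (hi.const_mul (2 * B)) ?_).trans ?_
    · refine Filter.Eventually.of_forall fun θ => ?_
      by_cases hc : corner M x θ = corner M y θ
      · rw [hc, sub_self, norm_zero]
        positivity
      · have : ∃ j ∈ Finset.range (N + 1), pA M x θ j ≠ pA M y θ j := by
          by_contra! h
          apply hc
          funext i
          unfold corner
          rw [h i (by have := i.2; simp only [Finset.mem_range]; omega), h (i + 1)
            (by have := i.2; simp only [Finset.mem_range]; omega)]
        obtain ⟨j, hj, hne⟩ := this
        have h1 : (1 : ℝ) ≤ |((pA M x θ j : ℤ) : ℝ) - (pA M y θ j : ℤ)| := by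
          have : (1 : ℤ) ≤ |pA M x θ j - pA M y θ j| := Int.one_le_abs (sub_ne_zero.2 hne)
          exact_mod_cast this
        have h2 := Finset.single_le_sum (f := fun j => |((pA M x θ j : ℤ) : ℝ) - (pA M y θ j : ℤ)|)
          (fun j _ => abs_nonneg _) hj
        calc ‖W (corner M x θ) - W (corner M y θ)‖ ≤ B + B :=
              (norm_sub_le _ _).trans (add_le_add (hB _) (hB _))
          _ = 2 * B * 1 := by ring
          _ ≤ _ := mul_le_mul_of_nonneg_left (h1.trans h2) (by positivity)
    · rw [MeasureTheory.integral_const_mul]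
      apply mul_le_mul_of_nonneg_left _ (by positivity)
      have hi' : ∀ j ∈ Finset.range (N + 1), MeasureTheory.IntegrableOn (fun θ =>
          |((pA M x θ j : ℤ) : ℝ) - (pA M y θ j : ℤ)|) (Ico (0 : ℝ) 1) :=
        fun j _ => (floor_int' _ _).1
      rw [MeasureTheory.integral_finsetSum _ hi']
      have : ∀ j ∈ Finset.range (N + 1), ∫ θ in Ico (0 : ℝ) 1,
          |((pA M x θ j : ℤ) : ℝ) - (pA M y θ j : ℤ)| ≤ M * (N * ‖x - y‖) := by
        intro j _
        unfold pA
        rw [(floor_int' _ _).2, ← mul_sub, abs_mul, Nat.abs_cast]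
        exact mul_le_mul_of_nonneg_left (hS x y j) (by positivity)
      refine (Finset.sum_le_sum this).trans ?_
      simp
  refine ⟨⟨2 * B * ((N + 1) * (M * N)), by positivity⟩, LipschitzWith.of_dist_le_mul fun x y => ?_⟩
  rw [dist_eq_norm, dist_eq_norm]
  refine (key x y).trans (le_of_eq ?_)
  change _ = (2 * B * ((N + 1) * (M * N))) * ‖x - y‖
  ring


lemma union_bound {U T : Type*} [Fintype U] [Nonempty U] (S : Finset T) (bad : T → U → Prop)
    (A Kk : ℕ) (h : ∀ t ∈ S, A * (Finset.univ.filter (fun u => bad t u)).card ≤ Kk * Fintype.card U)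
    (hlt : S.card * Kk < A) : ∃ u, ∀ t ∈ S, ¬ bad t u := by
  by_contra! hcon
  have h1 : (Finset.univ : Finset U) ⊆ S.biUnion (fun t => Finset.univ.filter (fun u => bad t u)) := by
    intro u _
    obtain ⟨t, ht, hb⟩ := hcon u
    simp only [Finset.mem_biUnion, Finset.mem_filter, Finset.mem_univ, true_and]
    exact ⟨t, ht, hb⟩
  have h2 := (Finset.card_le_card h1).trans Finset.card_biUnion_le
  have h3 : A * Fintype.card U ≤ S.card * Kk * Fintype.card U := by
    calc A * Fintype.card U ≤ A * ∑ t ∈ S, (Finset.univ.filter (fun u => bad t u)).card :=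
          Nat.mul_le_mul_left _ h2
      _ = ∑ t ∈ S, A * (Finset.univ.filter (fun u => bad t u)).card := Finset.mul_sum _ _ _
      _ ≤ ∑ t ∈ S, Kk * Fintype.card U := Finset.sum_le_sum h
      _ = _ := by rw [Finset.sum_const, smul_eq_mul, mul_assoc]
  have := Nat.le_of_mul_le_mul_right h3 Fintype.card_pos
  omega

lemma stage2_event (k n D m H : ℕ) (hm : 1 ≤ m) (c c' : Fin (k + 1) → Fin D)
    (hcc : ∀ i j, c i ≠ c' j) (z z' : Fin (k + 1) → Fin n → ℝ) (ν ν' : Fin (k + 1) → ℕ)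
    (hν : ν ∈ (Finset.univ : Finset (Fin (k + 1))).piAntidiag m) :
    m ^ n * (Finset.univ.filter (fun u : Fin D → Fin n → Fin m => ∀ l : Fin n,
      |∑ i, (ν i : ℝ) * (z i l + ((u (c i) l : ℕ) : ℝ) / m) -
        ∑ i, (ν' i : ℝ) * (z' i l + ((u (c' i) l : ℕ) : ℝ) / m)| ≤ H)).card ≤
      (2 * H * (k + 1) + 1) ^ n * Fintype.card (Fin D → Fin n → Fin m) := by
  obtain ⟨i0, _, hi0⟩ := exists_big_coord Finset.univ m k hm (by simp) ν hν
  have hm0 : (0 : ℝ) < m := by exact_mod_cast hm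
  have key := count_update (ι := Fin D) (α := Fin n → Fin m) (c i0) (fun _ => True)
    (fun u => ∀ l : Fin n,
      |∑ i, (ν i : ℝ) * (z i l + ((u (c i) l : ℕ) : ℝ) / m) -
        ∑ i, (ν' i : ℝ) * (z' i l + ((u (c' i) l : ℕ) : ℝ) / m)| ≤ H)
    ((2 * H * (k + 1) + 1) ^ n) (fun _ _ => Iff.rfl) ?_
  · simp only [true_and, Fintype.card_pi, Finset.prod_const, Finset.card_univ, Fintype.card_fin,
      Finset.filter_true] at key
    convert key using 2
    simp
  · intro P
    let β : ℝ := ∑ i, if c i = c i0 then (ν i : ℝ) / m else 0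
    have hβ : 1 ≤ β * (k + 1) := by
      have h1 : (ν i0 : ℝ) / m ≤ β := by
        have := Finset.single_le_sum (f := fun i => if c i = c i0 then (ν i : ℝ) / m else 0)
          (fun i _ => by split_ifs <;> positivity) (Finset.mem_univ i0)
        simpa using this
      have h2 : (m : ℝ) ≤ ν i0 * (k + 1) := by exact_mod_cast hi0
      calc (1 : ℝ) ≤ (ν i0 : ℝ) / m * (k + 1) := by
            rw [div_mul_eq_mul_div, le_div_iff₀ hm0]; linarith
        _ ≤ _ := mul_le_mul_of_nonneg_right h1 (by positivity)
    let A : Fin n → ℝ := fun l => (∑ i, (ν i : ℝ) * (z i l + if c i = c i0 then 0 else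
        ((P (c i) l : ℕ) : ℝ) / m)) - ∑ i, (ν' i : ℝ) * (z' i l + ((P (c' i) l : ℕ) : ℝ) / m)
    have hcb := count_box n m A β H k hβ
    refine le_trans (le_of_eq ?_) hcb
    congr 1
    ext w
    simp only [Finset.mem_filter, Finset.mem_univ, true_and]
    apply forall_congr'
    intro l
    have e : ∑ i, (ν i : ℝ) * (z i l + ((update P (c i0) w (c i) l : ℕ) : ℝ) / m) -
        ∑ i, (ν' i : ℝ) * (z' i l + ((update P (c i0) w (c' i) l : ℕ) : ℝ) / m) =
        A l + β * (w l : ℕ) := by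
      have e2 : ∀ i, update P (c i0) w (c' i) = P (c' i) := fun i =>
        update_of_ne (hcc i0 i).symm _ _
      simp only [e2, A, β]
      rw [sub_add_eq_add_sub, Finset.sum_mul, ← Finset.sum_add_distrib]
      congr 1
      apply Finset.sum_congr rfl
      intro i _
      by_cases h : c i = c i0
      · simp [h]; ring
      · simp [h]
    rw [e]

lemma mem_hull_range {k n : ℕ} (w : Fin (k + 1) → Fin n → ℝ) (x : Fin n → ℝ)
    (hx : x ∈ convexHull ℝ (range w)) :
    ∃ lam : Fin (k + 1) → ℝ, (∀ i, 0 ≤ lam i) ∧ ∑ i, lam i = 1 ∧ x = ∑ i, lam i • w i := by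
  have : convexHull ℝ (range w) ⊆ (Fintype.linearCombination ℝ w) '' (stdSimplex ℝ (Fin (k + 1))) := by
    apply convexHull_min
    · rintro _ ⟨i, rfl⟩
      refine ⟨Pi.single i 1, single_mem_stdSimplex ℝ i, ?_⟩
      simp
    · exact (convex_stdSimplex ℝ _).linear_image _
  obtain ⟨lam, ⟨h1, h2⟩, rfl⟩ := this hx
  exact ⟨lam, h1, h2, by rw [Fintype.linearCombination_apply]⟩

lemma round_err {k n : ℕ} (m : ℕ) (w : Fin (k + 1) → Fin n → ℝ) (B : ℝ) (hw : ∀ i l, |w i l| ≤ B)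
    (lam : Fin (k + 1) → ℝ) (ν : Fin (k + 1) → ℕ) (h : ∀ i, |(ν i : ℝ) - m * lam i| ≤ 1) (l : Fin n) :
    |∑ i, (ν i : ℝ) * w i l - m * (∑ i, lam i • w i) l| ≤ (k + 1) * B := by
  have hB : 0 ≤ B := (abs_nonneg _).trans (hw 0 l)
  rw [Finset.sum_apply, Finset.mul_sum, ← Finset.sum_sub_distrib]
  refine (Finset.abs_sum_le_sum_abs _ _).trans ?_
  have : ∀ i ∈ (Finset.univ : Finset (Fin (k + 1))),
      |(ν i : ℝ) * w i l - m * (lam i • w i) l| ≤ B := by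
    intro i _
    have e : (ν i : ℝ) * w i l - m * (lam i • w i) l = ((ν i : ℝ) - m * lam i) * w i l := by
      simp only [Pi.smul_apply, smul_eq_mul]; ring
    rw [e, abs_mul]
    calc _ ≤ 1 * B := mul_le_mul (h i) (hw i l) (abs_nonneg _) zero_le_one
      _ = B := one_mul _
  refine (Finset.sum_le_sum this).trans ?_
  simp

lemma stage2 (k n K' : ℕ) (hn : 2 * k + 1 ≤ n) : ∃ C : ℕ, 1 ≤ C ∧ ∀ D : ℕ, 1 ≤ D →
    ∃ f : Fin D → Fin n → ℝ, (∀ c l, 0 ≤ f c l ∧ f c l ≤ 1) ∧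
    ∀ c c' : Fin (k + 1) → Fin D, (∀ i j, c i ≠ c' j) →
    ∀ z z' : Fin (k + 1) → Fin n → ℤ, (∀ i l, |z i l| ≤ K') → (∀ i l, |z' i l| ≤ K') →
    ∀ x ∈ convexHull ℝ (range fun i l => (z i l : ℝ) + f (c i) l),
    ∀ y ∈ convexHull ℝ (range fun i l => (z' i l : ℝ) + f (c' i) l),
    1 / ((C * D ^ (2 * k + 2) : ℕ) : ℝ) ≤ ‖x - y‖ := by
  set H := 1 + 2 * ((k + 1) * (K' + 1)) with hH
  set Kk := (2 * H * (k + 1) + 1) ^ n with hKk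
  set Z := ((2 * K' + 1) ^ n) ^ (k + 1) with hZ
  set C' := 4 ^ k * (Z * Z) * Kk with hC'
  refine ⟨C' + 1, by omega, fun D hD => ?_⟩
  set m := (C' + 1) * D ^ (2 * k + 2) with hm
  have hDp : 1 ≤ D ^ (2 * k + 2) := Nat.one_le_pow _ _ hD
  have hm1 : 1 ≤ m := Nat.mul_pos (by omega) hDp
  have : Nonempty (Fin m) := ⟨⟨0, hm1⟩⟩
  let P := (Finset.univ : Finset (Fin (k + 1))).piAntidiag m
  let ZZ := Fintype.piFinset (fun _ : Fin (k + 1) => Fintype.piFinset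
    (fun _ : Fin n => Finset.Icc (-(K' : ℤ)) K'))
  let CC := (Finset.univ : Finset ((Fin (k + 1) → Fin D) × (Fin (k + 1) → Fin D))).filter
    (fun c => ∀ i j, c.1 i ≠ c.2 j)
  let S := (CC ×ˢ (ZZ ×ˢ ZZ)) ×ˢ (P ×ˢ P)
  have hScard : S.card ≤ (D ^ (2 * k + 2) * (Z * Z)) * ((m + 1) ^ k * (m + 1) ^ k) := by
    have hP : P.card ≤ (m + 1) ^ k := card_piAntidiag_le _ m k (by simp)
    have hZZ : ZZ.card = Z := by
      simp only [ZZ, Fintype.card_piFinset, Finset.prod_const, Finset.card_univ, Fintype.card_fin,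
        Int.card_Icc, hZ]
      congr 2; omega
    have hCC : CC.card ≤ D ^ (2 * k + 2) := by
      refine (Finset.card_filter_le _ _).trans (le_of_eq ?_)
      simp only [Finset.card_univ, Fintype.card_prod, Fintype.card_pi, Finset.prod_const,
        Fintype.card_fin]
      rw [← pow_add]; congr 1; ring
    simp only [S, Finset.card_product]
    rw [hZZ]
    exact Nat.mul_le_mul (Nat.mul_le_mul_right _ hCC) (Nat.mul_le_mul hP hP)
  obtain ⟨u, hu⟩ := union_bound (U := Fin D → Fin n → Fin m) S (fun t u => ∀ l : Fin n,
      |∑ i, (t.2.1 i : ℝ) * ((t.1.2.1 i l : ℝ) + ((u (t.1.1.1 i) l : ℕ) : ℝ) / m) -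
        ∑ i, (t.2.2 i : ℝ) * ((t.1.2.2 i l : ℝ) + ((u (t.1.1.2 i) l : ℕ) : ℝ) / m)| ≤ H) (m ^ n) Kk
    (by
      rintro ⟨⟨⟨c, c'⟩, z, z'⟩, ν, ν'⟩ ht
      simp only [S, Finset.mem_product] at ht
      have hcc := (Finset.mem_filter.1 ht.1.1).2
      have := stage2_event k n D m H hm1 c c' hcc (fun i l => (z i l : ℝ)) (fun i l => (z' i l : ℝ))
        ν ν' ht.2.1
      convert this)
    (by
      have e1 : (m + 1) ^ k * (m + 1) ^ k ≤ 4 ^ k * (m ^ k * m ^ k) := by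
        rw [← mul_pow, ← mul_pow, ← mul_pow]
        apply Nat.pow_le_pow_left
        nlinarith
      calc S.card * Kk ≤ (D ^ (2 * k + 2) * (Z * Z)) * (4 ^ k * (m ^ k * m ^ k)) * Kk :=
            Nat.mul_le_mul_right _ (hScard.trans (Nat.mul_le_mul_left _ e1))
        _ = (C' * D ^ (2 * k + 2)) * m ^ (2 * k) := by rw [hC', two_mul k, pow_add m]; ring
        _ < m * m ^ (2 * k) := by
            apply Nat.mul_lt_mul_of_pos_right _ (Nat.one_le_pow _ _ hm1)
            rw [hm, add_mul]; omega
        _ = m ^ (2 * k + 1) := by rw [pow_succ, mul_comm]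
        _ ≤ m ^ n := Nat.pow_le_pow_right hm1 hn)
  have hm0 : (0 : ℝ) < m := by exact_mod_cast hm1
  clear_value m
  refine ⟨fun c l => ((u c l : ℕ) : ℝ) / m, fun c l => ⟨by positivity, ?_⟩, ?_⟩
  · rw [div_le_one hm0]; exact_mod_cast (u c l).2.le
  intro c c' hcc z z' hz hz' x hx y hy
  by_contra! hlt
  obtain ⟨lam, l1, l2, rfl⟩ := mem_hull_range _ x hx
  obtain ⟨mu, m1, m2, rfl⟩ := mem_hull_range _ y hy
  have hν := corner_mem m lam l1 l2 0 Finset.univ (by simp)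
  have hν' := corner_mem m mu m1 m2 0 Finset.univ (by simp)
  have hwb : ∀ (z : Fin (k + 1) → Fin n → ℤ) (c : Fin (k + 1) → Fin D), (∀ i l, |z i l| ≤ K') →
      ∀ i l, |(z i l : ℝ) + ((u (c i) l : ℕ) : ℝ) / m| ≤ (K' : ℝ) + 1 := by
    intro z c hz i l
    have h1 : |(z i l : ℝ)| ≤ K' := by exact_mod_cast hz i l
    have h2 : ((u (c i) l : ℕ) : ℝ) / m ≤ 1 := by
      rw [div_le_one hm0]; exact_mod_cast (u (c i) l).2.le
    refine (abs_add_le _ _).trans (add_le_add h1 ?_)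
    rw [abs_of_nonneg (by positivity)]; exact h2
  have hmemZ : ∀ z : Fin (k + 1) → Fin n → ℤ, (∀ i l, |z i l| ≤ K') → z ∈ ZZ := by
    intro z hz
    simp only [ZZ, Fintype.mem_piFinset, Finset.mem_Icc]
    exact fun i l => abs_le.1 (hz i l)
  refine hu (((c, c'), z, z'), corner m lam 0, corner m mu 0) ?_ ?_
  · simp only [S, Finset.mem_product]
    refine ⟨⟨?_, hmemZ z hz, hmemZ z' hz'⟩, hν, hν'⟩
    simp only [CC, Finset.mem_filter, Finset.mem_univ, true_and]
    exact hcc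
  · intro l
    have r1 := round_err m (fun i l => (z i l : ℝ) + ((u (c i) l : ℕ) : ℝ) / m) _ (hwb z c hz) lam
      (corner m lam 0) (corner_approx m lam l1 0) l
    have r2 := round_err m (fun i l => (z' i l : ℝ) + ((u (c' i) l : ℕ) : ℝ) / m) _ (hwb z' c' hz') mu
      (corner m mu 0) (corner_approx m mu m1 0) l
    have r3 := (norm_le_pi_norm (_ - _) l).trans_lt hlt
    rw [Pi.sub_apply, Real.norm_eq_abs] at r3
    simp only
    set X := (∑ i, lam i • fun l => (z i l : ℝ) + ((u (c i) l : ℕ) : ℝ) / m) l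
    set Y := (∑ i, mu i • fun l => (z' i l : ℝ) + ((u (c' i) l : ℕ) : ℝ) / m) l
    have r4 : |m * X - m * Y| ≤ 1 := by
      rw [← mul_sub, abs_mul, Nat.abs_cast]
      have := mul_lt_mul_of_pos_left r3 hm0
      rw [mul_one_div_cancel hm0.ne'] at this
      exact this.le
    rw [abs_le] at r1 r2 r4 ⊢
    rw [hH]
    push_cast
    constructor <;> linarith [r1.1, r1.2, r2.1, r2.2, r4.1, r4.2]


def InFace {N : ℕ} (s : Finset (Fin N)) (x : Fin N → ℝ) : Prop :=
  (∀ i, 0 ≤ x i) ∧ ∑ i, x i = 1 ∧ ∀ i, i ∉ s → x i = 0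

lemma base_close {N n k : ℕ} (M : ℕ) (Q : ℝ) (p : Fin N → Fin n → ℝ) (hp : ∀ v l, |p v l| ≤ Q)
    (s : Finset (Fin N)) (hs : s.card ≤ k + 1) (x : Fin N → ℝ) (hx : InFace s x) (θ : ℝ) (l : Fin n)
    (hQ : 0 ≤ Q) :
    |∑ v, (corner M x θ v : ℝ) * p v l - ∑ v, (M * x v) * p v l| ≤ (k + 1) * Q := by
  have hc := corner_mem M x hx.1 hx.2.1 θ s hx.2.2
  rw [Finset.mem_piAntidiag] at hc
  rw [← Finset.sum_sub_distrib]
  have e : ∑ v, ((corner M x θ v : ℝ) * p v l - (M * x v) * p v l) =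
      ∑ v ∈ s, ((corner M x θ v : ℝ) * p v l - (M * x v) * p v l) := by
    symm
    apply Finset.sum_subset (Finset.subset_univ _)
    intro v _ hv
    have h0 : corner M x θ v = 0 := by by_contra h; exact hv (hc.2 v h)
    rw [h0, hx.2.2 v hv]; simp
  rw [e]
  refine (Finset.abs_sum_le_sum_abs _ _).trans ?_
  have : ∀ v ∈ s, |(corner M x θ v : ℝ) * p v l - (M * x v) * p v l| ≤ Q := by
    intro v _
    rw [← sub_mul, abs_mul]
    calc _ ≤ 1 * Q := mul_le_mul (corner_approx M x hx.1 θ v) (hp v l) (abs_nonneg _) zero_le_one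
      _ = Q := one_mul _
  refine (Finset.sum_le_sum this).trans ?_
  rw [Finset.sum_const, nsmul_eq_mul]
  apply mul_le_mul_of_nonneg_right _ hQ
  exact_mod_cast hs

lemma base_bound {N n : ℕ} (M : ℕ) (Q : ℝ) (p : Fin N → Fin n → ℝ) (hp : ∀ v l, |p v l| ≤ Q)
    (s : Finset (Fin N)) (x : Fin N → ℝ) (hx : InFace s x) (l : Fin n) :
    |∑ v, (M * x v) * p v l| ≤ M * Q := by
  calc _ ≤ ∑ v, |(M * x v) * p v l| := Finset.abs_sum_le_sum_abs _ _
    _ ≤ ∑ v, (M * x v) * Q := Finset.sum_le_sum fun v _ => by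
        have h0 : (0 : ℝ) ≤ M * x v := mul_nonneg (Nat.cast_nonneg _) (hx.1 v)
        rw [abs_mul, abs_of_nonneg h0]
        exact mul_le_mul_of_nonneg_left (hp v l) h0
    _ = _ := by rw [← Finset.sum_mul, ← Finset.mul_sum, hx.2.1, mul_one]

/-- geometric core: from stage-1 and stage-2 data get a thick map -/
lemma thick_core (k n N M m K2 Q D : ℕ) (hM : 1 ≤ M) (hm : 1 ≤ m) (hK2 : K2 = (k + 1) * Q + 2)
    (F : Finset (Finset (Fin N))) (hFk : ∀ s ∈ F, s.card ≤ k + 1)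
    (p : Fin N → Fin n → ℝ) (hp : ∀ v l, |p v l| ≤ Q)
    (col : (Fin N → ℕ) → Fin D)
    (hcol : ∀ a ∈ F.biUnion (fun s => s.piAntidiag M), ∀ b ∈ F.biUnion (fun s => s.piAntidiag M),
      a ≠ b → (∀ l : Fin n, |⌊∑ v, (b v : ℝ) * p v l⌋ - ⌊∑ v, (a v : ℝ) * p v l⌋| ≤
        ((4 * K2 + 1 : ℕ) : ℤ)) → col a ≠ col b)
    (f : Fin D → Fin n → ℝ) (hf : ∀ c l, 0 ≤ f c l ∧ f c l ≤ 1)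
    (hst : ∀ c c' : Fin (k + 1) → Fin D, (∀ i j, c i ≠ c' j) →
      ∀ z z' : Fin (k + 1) → Fin n → ℤ, (∀ i l, |z i l| ≤ ((4 * K2 + 1 : ℕ) : ℤ)) →
      (∀ i l, |z' i l| ≤ ((4 * K2 + 1 : ℕ) : ℤ)) →
      ∀ x ∈ convexHull ℝ (range fun i l => (z i l : ℝ) + f (c i) l),
      ∀ y ∈ convexHull ℝ (range fun i l => (z' i l : ℝ) + f (c' i) l), 1 / (m : ℝ) ≤ ‖x - y‖) :
    ∃ (g : (Fin N → ℝ) → Fin n → ℝ) (Cl : NNReal), LipschitzWith Cl g ∧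
      (∀ s ∈ F, ∀ x, InFace s x → ‖g x‖ ≤ M * Q + K2) ∧
      ∀ s ∈ F, ∀ t ∈ F, Disjoint s t → ∀ x y, InFace s x → InFace t y → 1 / (m : ℝ) ≤ ‖g x - g y‖ := by
  set Λ := F.biUnion (fun s => s.piAntidiag M) with hΛ
  let fl : (Fin N → ℕ) → Fin n → ℤ := fun a l => ⌊∑ v, (a v : ℝ) * p v l⌋
  let W : (Fin N → ℕ) → Fin n → ℝ := fun a => if a ∈ Λ then fun l => (fl a l : ℝ) + f (col a) l else 0
  let Bs : (Fin N → ℝ) → Fin n → ℝ := fun x l => ∑ v, (M * x v) * p v l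
  have hW : ∀ a, ‖W a‖ ≤ ∑ a ∈ Λ, ‖W a‖ := by
    intro a
    by_cases ha : a ∈ Λ
    · exact Finset.single_le_sum (f := fun a => ‖W a‖) (fun _ _ => norm_nonneg _) ha
    · have : W a = 0 := by simp only [W, if_neg ha]
      rw [this, norm_zero]
      exact Finset.sum_nonneg fun _ _ => norm_nonneg _
  obtain ⟨Cl, hCl⟩ := pg_lip M W _ hW
  have hmemΛ : ∀ s ∈ F, ∀ x, InFace s x → ∀ θ, corner M x θ ∈ Λ := fun s hs x hx θ =>
    Finset.mem_biUnion.2 ⟨s, hs, corner_mem M x hx.1 hx.2.1 θ s hx.2.2⟩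
  have hK2r : (K2 : ℝ) = (k + 1) * Q + 2 := by rw [hK2]; push_cast; ring
  have hflo : ∀ s ∈ F, ∀ x, InFace s x → ∀ θ l, |(fl (corner M x θ) l : ℝ) - Bs x l| ≤ K2 - 1 := by
    intro s hs x hx θ l
    have h := abs_le.1 (base_close (k := k) M Q p hp s (hFk s hs) x hx θ l (by positivity))
    have h1 := Int.floor_le (∑ v, (corner M x θ v : ℝ) * p v l)
    have h2 := Int.lt_floor_add_one (∑ v, (corner M x θ v : ℝ) * p v l)
    simp only [fl, Bs]
    rw [hK2r, abs_le]
    constructor <;> linarith [h.1, h.2]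
  have hWc : ∀ s ∈ F, ∀ x, InFace s x → ∀ θ, W (corner M x θ) ∈ closedBall (Bs x) K2 := by
    intro s hs x hx θ
    rw [mem_closedBall, dist_eq_norm, pi_norm_le_iff_of_nonneg (by positivity)]
    intro l
    simp only [W, if_pos (hmemΛ s hs x hx θ), Pi.sub_apply, Real.norm_eq_abs]
    have h := abs_le.1 (hflo s hs x hx θ l)
    have h2 := hf (col (corner M x θ)) l
    rw [abs_le]
    constructor <;> linarith [h.1, h.2, h2.1, h2.2]
  have hgB : ∀ s ∈ F, ∀ x, InFace s x → ‖pg M W x - Bs x‖ ≤ K2 := by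
    intro s hs x hx
    obtain ⟨c, hc1, hc2⟩ := corner_finite k M x hx.2.1 s hx.2.2 (hFk s hs)
    have h := pg_mem k M W _ hW x c hc2
    have h2 : convexHull ℝ (range fun t => W (c t)) ⊆ closedBall (Bs x) K2 := by
      apply convexHull_min _ (convex_closedBall _ _)
      rintro _ ⟨t, rfl⟩
      obtain ⟨θ, _, h⟩ := hc1 t
      simp only [h]
      exact hWc s hs x hx θ
    have := h2 h
    rwa [mem_closedBall, dist_eq_norm] at this
  refine ⟨pg M W, Cl, hCl, ?_, ?_⟩
  · intro s hs x hx
    have h1 : ‖Bs x‖ ≤ M * Q := by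
      rw [pi_norm_le_iff_of_nonneg (by positivity)]
      exact fun l => base_bound M Q p hp s x hx l
    calc ‖pg M W x‖ = ‖Bs x + (pg M W x - Bs x)‖ := by congr 1; abel
      _ ≤ ‖Bs x‖ + ‖pg M W x - Bs x‖ := norm_add_le _ _
      _ ≤ _ := add_le_add h1 (hgB s hs x hx)
  · intro s hs t ht hst' x y hx hy
    have hm0 : (1 : ℝ) ≤ m := by exact_mod_cast hm
    by_cases hfar : 2 * (K2 : ℝ) + 1 < ‖Bs x - Bs y‖
    · have h1 := hgB s hs x hx
      have h2 := hgB t ht y hy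
      have h3 : ‖Bs x - Bs y‖ ≤ ‖pg M W x - pg M W y‖ + ‖pg M W x - Bs x‖ + ‖pg M W y - Bs y‖ := by
        calc ‖Bs x - Bs y‖ = ‖(pg M W x - pg M W y) - (pg M W x - Bs x) + (pg M W y - Bs y)‖ := by
              congr 1; abel
          _ ≤ ‖(pg M W x - pg M W y) - (pg M W x - Bs x)‖ + ‖pg M W y - Bs y‖ := norm_add_le _ _
          _ ≤ _ := add_le_add (norm_sub_le _ _) le_rfl
      have h4 : 1 / (m : ℝ) ≤ 1 := by rw [div_le_one (by linarith)]; exact hm0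
      linarith
    · push Not at hfar
      obtain ⟨a, ha1, ha2⟩ := corner_finite k M x hx.2.1 s hx.2.2 (hFk s hs)
      obtain ⟨b, hb1, hb2⟩ := corner_finite k M y hy.2.1 t hy.2.2 (hFk t ht)
      have hgx := pg_mem k M W _ hW x a ha2
      have hgy := pg_mem k M W _ hW y b hb2
      have haΛ : ∀ i, a i ∈ Λ := fun i => by
        obtain ⟨θ, _, h⟩ := ha1 i; rw [h]; exact hmemΛ s hs x hx θ
      have hbΛ : ∀ i, b i ∈ Λ := fun i => by
        obtain ⟨θ, _, h⟩ := hb1 i; rw [h]; exact hmemΛ t ht y hy θ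
      have hfa : ∀ i l, |(fl (a i) l : ℝ) - Bs x l| ≤ K2 - 1 := fun i l => by
        obtain ⟨θ, _, h⟩ := ha1 i; rw [h]; exact hflo s hs x hx θ l
      have hfb : ∀ i l, |(fl (b i) l : ℝ) - Bs y l| ≤ K2 - 1 := fun i l => by
        obtain ⟨θ, _, h⟩ := hb1 i; rw [h]; exact hflo t ht y hy θ l
      have hBl : ∀ l, |Bs x l - Bs y l| ≤ 2 * (K2 : ℝ) + 1 := fun l =>
        (norm_le_pi_norm (Bs x - Bs y) l).trans hfar
      have hd1 : ∀ i l, |fl (a i) l - fl (a 0) l| ≤ ((4 * K2 + 1 : ℕ) : ℤ) := by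
        intro i l
        have h1 := abs_le.1 (hfa i l)
        have h2 := abs_le.1 (hfa 0 l)
        have : |(fl (a i) l : ℝ) - fl (a 0) l| ≤ ((4 * K2 + 1 : ℕ) : ℝ) := by
          push_cast; rw [abs_le]; constructor <;> linarith [h1.1, h1.2, h2.1, h2.2]
        exact_mod_cast this
      have hd2 : ∀ i j l, |fl (b j) l - fl (a i) l| ≤ ((4 * K2 + 1 : ℕ) : ℤ) := by
        intro i j l
        have h1 := abs_le.1 (hfb j l)
        have h2 := abs_le.1 (hfa i l)
        have h3 := abs_le.1 (hBl l)
        have : |(fl (b j) l : ℝ) - fl (a i) l| ≤ ((4 * K2 + 1 : ℕ) : ℝ) := by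
          push_cast; rw [abs_le]; constructor <;> linarith [h1.1, h1.2, h2.1, h2.2, h3.1, h3.2]
        exact_mod_cast this
      have hab : ∀ i j, a i ≠ b j := by
        intro i j hij
        obtain ⟨θ, _, h1⟩ := ha1 i
        obtain ⟨θ', _, h2⟩ := hb1 j
        have c1 := corner_mem M x hx.1 hx.2.1 θ s hx.2.2
        have c2 := corner_mem M y hy.1 hy.2.1 θ' t hy.2.2
        rw [← h1, hij] at c1
        rw [← h2] at c2
        rw [Finset.mem_piAntidiag] at c1 c2
        have : s.sum (b j) = 0 := Finset.sum_eq_zero fun v hv => by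
          by_contra h
          exact (Finset.disjoint_left.1 hst' hv) (c2.2 v h)
        omega
      have hcc : ∀ i j, col (a i) ≠ col (b j) := fun i j =>
        hcol (a i) (haΛ i) (b j) (hbΛ j) (hab i j) (hd2 i j)
      have key := hst (fun i => col (a i)) (fun i => col (b i)) hcc
        (fun i l => fl (a i) l - fl (a 0) l) (fun i l => fl (b i) l - fl (a 0) l) hd1 (fun j l => hd2 0 j l)
      let τ : Fin n → ℝ := fun l => (fl (a 0) l : ℝ)
      have htr : ∀ (c : Fin (k + 1) → Fin N → ℕ), (∀ i, c i ∈ Λ) → ∀ w ∈ convexHull ℝ (range fun i => W (c i)),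
          w - τ ∈ convexHull ℝ (range fun i l => ((fl (c i) l - fl (a 0) l : ℤ) : ℝ) + f (col (c i)) l) := by
        intro c hc w hw
        obtain ⟨lam, l1, l2, rfl⟩ := mem_hull_range _ w hw
        have e : (∑ i, lam i • W (c i)) - τ =
            ∑ i, lam i • (fun l => ((fl (c i) l - fl (a 0) l : ℤ) : ℝ) + f (col (c i)) l) := by
          have : τ = ∑ i, lam i • τ := by rw [← Finset.sum_smul, l2, one_smul]
          rw [this, ← Finset.sum_sub_distrib]
          apply Finset.sum_congr rfl
          intro i _
          rw [← smul_sub]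
          congr 1
          funext l
          simp only [W, if_pos (hc i), Pi.sub_apply, τ]
          push_cast; ring
        rw [e]
        exact (convex_convexHull ℝ _).sum_mem (fun i _ => l1 i) l2
          (fun i _ => subset_convexHull ℝ _ ⟨i, rfl⟩)
      have := key _ (htr a haΛ _ hgx) _ (htr b hbΛ _ hgy)
      rwa [sub_sub_sub_cancel_right] at this

lemma assembly (k n L : ℕ) (hn : 2 * k + 1 ≤ n) : ∃ C : ℝ, 0 < C ∧
    ∀ (N : ℕ) (_ : 2 ≤ N) (F : Finset (Finset (Fin N))) (_ : ∀ s ∈ F, s.Nonempty)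
      (_ : ∀ s ∈ F, s.card ≤ k + 1) (_ : ∀ v, (F.filter (fun s => v ∈ s)).card ≤ L),
    ∃ (g : (Fin N → ℝ) → Fin n → ℝ) (Cl : NNReal), LipschitzWith Cl g ∧
      (∀ s ∈ F, ∀ x, InFace s x →
        ‖g x‖ ≤ C * (N : ℝ) ^ (((n : ℝ) - (k : ℝ))⁻¹) * Real.log N ^ (2 * k + 2)) ∧
      ∀ s ∈ F, ∀ t ∈ F, Disjoint s t → ∀ x y, InFace s x → InFace t y → 2 ≤ ‖g x - g y‖ := by
  obtain ⟨Q, hQ⟩ := stage1 k n L hn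
  set K2 := (k + 1) * Q + 2 with hK2
  obtain ⟨C1, hC1⟩ := hQ (4 * K2 + 1)
  obtain ⟨C2, hC2, hs2⟩ := stage2 k n (4 * K2 + 1) hn
  refine ⟨2 * C2 * (C1 + 2) ^ (2 * k + 2) * (C1 * (Q + K2)) + 1, by positivity, ?_⟩
  intro N hN F hne hFk hL
  obtain ⟨M, D, p, hM, hMb, hDb, hp, hcount⟩ := hC1 N hN F hne hFk hL
  obtain ⟨col, hcol⟩ := greedy_color (F.biUnion (fun s => s.piAntidiag M))
    (fun a b => ∀ l : Fin n, |⌊∑ v, (b v : ℝ) * p v l⌋ - ⌊∑ v, (a v : ℝ) * p v l⌋| ≤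
        ((4 * K2 + 1 : ℕ) : ℤ)) (fun a b h l => by rw [abs_sub_comm]; exact h l) D
    (fun a _ => by
      have := hcount (fun l => ⌊∑ v, (a v : ℝ) * p v l⌋)
      convert this)
  obtain ⟨f, hf, hst⟩ := hs2 (D + 1) (by omega)
  set m := C2 * (D + 1) ^ (2 * k + 2) with hm
  have hm1 : 1 ≤ m := Nat.mul_pos hC2 (Nat.one_le_pow _ _ (by omega))
  obtain ⟨g, Cl, hg1, hg2, hg3⟩ := thick_core k n N M m K2 Q (D + 1) hM hm1 hK2 F hFk p hp col hcol f hf hst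
  have hm0 : (0 : ℝ) < m := by exact_mod_cast hm1
  have hnorm : ‖(2 * m : ℝ)‖ = 2 * m := by rw [Real.norm_eq_abs, abs_of_pos (by linarith)]
  refine ⟨fun x => (2 * m : ℝ) • g x, ‖(2 * m : ℝ)‖₊ * Cl, ?_, ?_, ?_⟩
  · refine LipschitzWith.of_dist_le_mul fun x y => ?_
    rw [dist_smul₀]
    push_cast
    rw [mul_assoc]
    exact mul_le_mul_of_nonneg_left (hg1.dist_le_mul x y) (norm_nonneg _)
  · intro s hs x hx
    rw [norm_smul, hnorm]
    have hlog : (1 / 2 : ℝ) ≤ Real.log N := by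
      have h1 : Real.log 2 ≤ Real.log N :=
        Real.log_le_log (by norm_num) (by exact_mod_cast hN)
      linarith [Real.log_two_gt_d9]
    have hD1 : ((D : ℝ) + 1) ≤ (C1 + 2) * Real.log N := by linarith
    have hmb : (m : ℝ) ≤ C2 * ((C1 + 2) ^ (2 * k + 2) * Real.log N ^ (2 * k + 2)) := by
      rw [hm]; push_cast
      rw [← mul_pow]
      exact mul_le_mul_of_nonneg_left (pow_le_pow_left₀ (by positivity) hD1 _) (by positivity)
    have hM1 : (1 : ℝ) ≤ M := by exact_mod_cast hM
    have hgb : ‖g x‖ ≤ C1 * (N : ℝ) ^ (((n : ℝ) - (k : ℝ))⁻¹) * (Q + K2) := by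
      calc ‖g x‖ ≤ M * Q + K2 := hg2 s hs x hx
        _ ≤ M * (Q + K2) := by
            rw [mul_add]
            have : (K2 : ℝ) ≤ M * K2 := le_mul_of_one_le_left (by positivity) hM1
            linarith
        _ ≤ _ := mul_le_mul_of_nonneg_right hMb (by positivity)
    have hα0 : (0 : ℝ) ≤ (N : ℝ) ^ (((n : ℝ) - (k : ℝ))⁻¹) := by positivity
    have hl0 : (0 : ℝ) ≤ Real.log N ^ (2 * k + 2) := by positivity
    calc 2 * (m : ℝ) * ‖g x‖ ≤ 2 * (C2 * ((C1 + 2) ^ (2 * k + 2) * Real.log N ^ (2 * k + 2))) *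
          (C1 * (N : ℝ) ^ (((n : ℝ) - (k : ℝ))⁻¹) * (Q + K2)) := by
          apply mul_le_mul _ hgb (norm_nonneg _) (by positivity)
          linarith
      _ = (2 * C2 * (C1 + 2) ^ (2 * k + 2) * (C1 * (Q + K2))) *
          (N : ℝ) ^ (((n : ℝ) - (k : ℝ))⁻¹) * Real.log N ^ (2 * k + 2) := by ring
      _ ≤ _ := by
          apply mul_le_mul_of_nonneg_right _ hl0
          apply mul_le_mul_of_nonneg_right _ hα0
          linarith
  · intro s hs t ht hdj x y hx hy
    rw [← smul_sub, norm_smul, hnorm]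
    have h := hg3 s hs t ht hdj x y hx hy
    calc (2 : ℝ) = 2 * m * (1 / m) := by field_simp
      _ ≤ _ := mul_le_mul_of_nonneg_left h (by positivity)


noncomputable def facePar {N : ℕ} (s : Finset (Fin N)) (i0 : Fin N)
    (u : {i // i ∈ s.erase i0} → ℝ) : Fin N → ℝ := fun i =>
  if h : i ∈ s.erase i0 then u ⟨i, h⟩ else if i = i0 then 1 - ∑ j, u j else 0

lemma facePar_contDiff {N : ℕ} (s : Finset (Fin N)) (i0 : Fin N) :
    ContDiff ℝ 1 (facePar s i0) := by
  rw [contDiff_pi]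
  intro i
  unfold facePar
  by_cases h : i ∈ s.erase i0
  · simp only [h, dite_true]; fun_prop
  · simp only [h, dite_false]
    by_cases h2 : i = i0
    · simp only [h2, if_true]; fun_prop
    · simp only [h2, if_false]; fun_prop

lemma facePar_surj {N : ℕ} (s : Finset (Fin N)) (i0 : Fin N) (hi0 : i0 ∈ s) (x : Fin N → ℝ)
    (hx : InFace s x) : facePar s i0 (fun i => x i) = x := by
  funext i
  unfold facePar
  by_cases h : i ∈ s.erase i0
  · simp only [h, dite_true]
  · simp only [h, dite_false]
    by_cases h2 : i = i0
    · simp only [h2, if_true]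
      have h3 : ∑ j : {i // i ∈ s.erase i0}, x j = ∑ j ∈ s.erase i0, x j :=
        Finset.sum_coe_sort (s.erase i0) x
      rw [h3]
      have h4 : ∑ j ∈ s, x j = 1 := by
        rw [← hx.2.1]
        exact Finset.sum_subset (Finset.subset_univ _) (fun i _ hi => hx.2.2 i hi)
      rw [← Finset.add_sum_erase s x hi0] at h4
      linarith
    · simp only [h2, if_false]
      symm; apply hx.2.2
      intro hi
      exact h (Finset.mem_erase.2 ⟨h2, hi⟩)

lemma dimH_faces {N : ℕ} (k : ℕ) (s t : Finset (Fin N)) (hs : s.Nonempty) (ht : t.Nonempty)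
    (hsk : s.card ≤ k + 1) (htk : t.card ≤ k + 1) :
    dimH ({x | InFace s x} ×ˢ {x | InFace t x} : Set ((Fin N → ℝ) × (Fin N → ℝ))) ≤ ((2 * k : ℕ) : ENNReal) := by
  obtain ⟨i0, hi0⟩ := hs
  obtain ⟨j0, hj0⟩ := ht
  let φ : ({i // i ∈ s.erase i0} → ℝ) × ({i // i ∈ t.erase j0} → ℝ) → (Fin N → ℝ) × (Fin N → ℝ) :=
    fun u => (facePar s i0 u.1, facePar t j0 u.2)
  have hφ : ContDiff ℝ 1 φ :=
    ((facePar_contDiff s i0).comp contDiff_fst).prodMk ((facePar_contDiff t j0).comp contDiff_snd)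
  have hsub : ({x | InFace s x} ×ˢ {x | InFace t x} : Set ((Fin N → ℝ) × (Fin N → ℝ))) ⊆ range φ := by
    rintro ⟨x, y⟩ ⟨hx, hy⟩
    exact ⟨(fun i => x i, fun i => y i), Prod.ext (facePar_surj s i0 hi0 x hx) (facePar_surj t j0 hj0 y hy)⟩
  refine (dimH_mono hsub).trans (hφ.dimH_range_le.trans ?_)
  apply Nat.cast_le.2
  rw [Module.finrank_prod, Module.finrank_fintype_fun_eq_card, Module.finrank_fintype_fun_eq_card,
    Fintype.card_coe, Fintype.card_coe, Finset.card_erase_of_mem hi0, Finset.card_erase_of_mem hj0]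
  omega

lemma generic_step {N n : ℕ} (k : ℕ) (hn : 2 * k + 1 ≤ n) (F : Finset (Finset (Fin N)))
    (hne : ∀ s ∈ F, s.Nonempty) (hFk : ∀ s ∈ F, s.card ≤ k + 1)
    (g : (Fin N → ℝ) → Fin n → ℝ) (Cl : NNReal) (hg : LipschitzWith Cl g) (v : Fin N) (ε : ℝ) (hε : 0 < ε) :
    ∃ w : Fin n → ℝ, ‖w‖ ≤ ε ∧ ∀ s ∈ F, ∀ t ∈ F, ∀ x y, InFace s x → InFace t y → x v ≠ y v →
      g x + x v • w ≠ g y + y v • w := by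
  let Φ : (Fin N → ℝ) × (Fin N → ℝ) → ℝ × (Fin n → ℝ) := fun q => (q.1 v - q.2 v, g q.2 - g q.1)
  have hev : LipschitzWith 1 (fun x : Fin N → ℝ => x v) := LipschitzWith.eval v
  have hΦ : ∃ C : NNReal, LipschitzWith C Φ :=
    ⟨_, ((hev.comp LipschitzWith.prod_fst).sub (hev.comp LipschitzWith.prod_snd)).prodMk
      ((hg.comp LipschitzWith.prod_snd).sub (hg.comp LipschitzWith.prod_fst))⟩
  obtain ⟨C, hΦ⟩ := hΦ
  let ψ : ℝ × (Fin n → ℝ) → Fin n → ℝ := fun q => q.1⁻¹ • q.2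
  let U : Set (ℝ × (Fin n → ℝ)) := {q | 0 < q.1}
  have hψ : ContDiffOn ℝ 1 ψ U := by
    have h1 : ContDiffOn ℝ 1 (fun q : ℝ × (Fin n → ℝ) => q.1⁻¹) U :=
      contDiff_fst.contDiffOn.inv (fun q hq => ne_of_gt hq)
    have h2 : ContDiffOn ℝ 1 (fun q : ℝ × (Fin n → ℝ) => q.2) U := contDiff_snd.contDiffOn
    exact h1.smul h2
  have hU : Convex ℝ U := by
    have : U = (LinearMap.fst ℝ ℝ (Fin n → ℝ)) ⁻¹' (Ioi 0) := rfl
    rw [this]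
    exact (convex_Ioi 0).linear_preimage _
  let bad : Set (Fin n → ℝ) := ⋃ q ∈ (F ×ˢ F : Finset (Finset (Fin N) × Finset (Fin N))),
    ψ '' (Φ '' ({x | InFace q.1 x} ×ˢ {x | InFace q.2 x}) ∩ U)
  have hbad : dimH bad < Module.finrank ℝ (Fin n → ℝ) := by
    have h1 : dimH bad ≤ ((2 * k : ℕ) : ENNReal) := by
      have hc : Set.Countable ((F ×ˢ F : Finset (Finset (Fin N) × Finset (Fin N))) :
          Set (Finset (Fin N) × Finset (Fin N))) :=
        Finset.countable_toSet _
      have := dimH_bUnion hc (fun q : Finset (Fin N) × Finset (Fin N) =>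
        ψ '' (Φ '' ({x | InFace q.1 x} ×ˢ {x | InFace q.2 x}) ∩ U))
      simp only [Finset.mem_coe] at this
      simp only [bad]
      rw [this]
      apply iSup₂_le
      intro q hq
      rw [Finset.mem_product] at hq
      refine (hψ.dimH_image_le hU inter_subset_right).trans ?_
      refine (dimH_mono inter_subset_left).trans ?_
      refine (hΦ.dimH_image_le _).trans ?_
      exact dimH_faces k q.1 q.2 (hne _ hq.1) (hne _ hq.2) (hFk _ hq.1) (hFk _ hq.2)
    refine h1.trans_lt ?_
    simp only [Module.finrank_fintype_fun_eq_card, Fintype.card_fin]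
    apply Nat.cast_lt.2
    omega
  obtain ⟨w, hw1, hw2⟩ := (dense_compl_of_dimH_lt_finrank hbad).exists_mem_open
    (isOpen_ball (x := (0 : Fin n → ℝ)) (ε := ε)) ⟨0, mem_ball_self hε⟩
  refine ⟨w, ?_, ?_⟩
  · rw [mem_ball_zero_iff] at hw2; exact hw2.le
  have key : ∀ s ∈ F, ∀ t ∈ F, ∀ x y, InFace s x → InFace t y → y v < x v →
      g x + x v • w ≠ g y + y v • w := by
    intro s hs t ht x y hx hy hlt heq
    apply hw1
    simp only [bad, mem_iUnion]
    refine ⟨(s, t), Finset.mem_product.2 ⟨hs, ht⟩, Φ (x, y), ⟨⟨(x, y), ⟨hx, hy⟩, rfl⟩, ?_⟩, ?_⟩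
    · change 0 < x v - y v
      linarith
    · change (x v - y v)⁻¹ • (g y - g x) = w
      have e : g y - g x = (x v - y v) • w := by
        rw [sub_smul, sub_eq_sub_iff_add_eq_add, add_comm, add_comm _ (g x)]
        rw [add_comm (y v • w)]
        exact heq.symm
      rw [e, smul_smul, inv_mul_cancel₀ (by linarith), one_smul]
  intro s hs t ht x y hx hy hxy
  rcases lt_or_gt_of_ne hxy with h | h
  · exact fun he => key t ht s hs y x hy hx h he.symm
  · exact key s hs t ht x y hx hy h

lemma generic_inj {N n : ℕ} (k : ℕ) (hn : 2 * k + 1 ≤ n) (F : Finset (Finset (Fin N)))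
    (hne : ∀ s ∈ F, s.Nonempty) (hFk : ∀ s ∈ F, s.card ≤ k + 1)
    (g : (Fin N → ℝ) → Fin n → ℝ) (Cl : NNReal) (hg : LipschitzWith Cl g) (ε : ℝ) (hε : 0 < ε) :
    ∃ (g' : (Fin N → ℝ) → Fin n → ℝ), Continuous g' ∧
      (∀ s x, InFace s x → ‖g' x - g x‖ ≤ ε) ∧
      ∀ s ∈ F, ∀ t ∈ F, ∀ x y, InFace s x → InFace t y → x ≠ y → g' x ≠ g' y := by
  have key : ∀ S : Finset (Fin N), ∃ w : Fin N → Fin n → ℝ, (∀ v, ‖w v‖ ≤ ε) ∧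
      ∀ s ∈ F, ∀ t ∈ F, ∀ x y, InFace s x → InFace t y → (∃ v ∈ S, x v ≠ y v) →
        g x + ∑ v, x v • w v ≠ g y + ∑ v, y v • w v := by
    intro S
    induction S using Finset.induction_on with
    | empty => exact ⟨0, fun v => by simp [hε.le], fun s _ t _ x y _ _ ⟨v, hv, _⟩ => by simp at hv⟩
    | insert v S hv ih =>
      obtain ⟨w, hw1, hw2⟩ := ih
      let L0 : (Fin N → ℝ) →L[ℝ] (Fin n → ℝ) :=
        ∑ u ∈ Finset.univ.erase v, (ContinuousLinearMap.proj (R := ℝ) (φ := fun _ : Fin N => ℝ) u).smulRight (w u)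
      have hL0 : ∀ x, L0 x = ∑ u ∈ Finset.univ.erase v, x u • w u := by
        intro x
        simp [L0]
      obtain ⟨wv, hwv1, hwv2⟩ := generic_step k hn F hne hFk (fun x => g x + L0 x) _
        (hg.add L0.lipschitz) v ε hε
      have hsum : ∀ x : Fin N → ℝ, ∑ u, x u • update w v wv u = L0 x + x v • wv := by
        intro x
        rw [← Finset.add_sum_erase _ _ (Finset.mem_univ v), hL0, add_comm]
        congr 1
        · apply Finset.sum_congr rfl
          intro u hu
          rw [update_of_ne (Finset.ne_of_mem_erase hu)]
        · simp
      have hsum' : ∀ x : Fin N → ℝ, ∑ u, x u • w u = L0 x + x v • w v := by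
        intro x
        rw [← Finset.add_sum_erase _ _ (Finset.mem_univ v), hL0, add_comm]
      refine ⟨update w v wv, ?_, ?_⟩
      · intro u
        by_cases h : u = v
        · subst h; simpa using hwv1
        · rw [update_of_ne h]; exact hw1 u
      · intro s hs t ht x y hx hy hex
        rw [hsum, hsum, ← add_assoc, ← add_assoc]
        by_cases hxy : x v = y v
        · have h2 := hw2 s hs t ht x y hx hy (by
            obtain ⟨u, hu, hne'⟩ := hex
            rw [Finset.mem_insert] at hu
            rcases hu with rfl | hu
            · exact absurd hxy hne'
            · exact ⟨u, hu, hne'⟩)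
          rw [hsum', hsum', ← add_assoc, ← add_assoc, hxy] at h2
          intro h3
          apply h2
          rw [hxy] at h3
          rw [add_right_cancel h3]
        · exact hwv2 s hs t ht x y hx hy hxy
  obtain ⟨w, hw1, hw2⟩ := key Finset.univ
  refine ⟨fun x => g x + ∑ v, x v • w v, ?_, ?_, ?_⟩
  · have := hg.continuous
    fun_prop
  · intro s x hx
    rw [add_sub_cancel_left]
    refine (norm_sum_le _ _).trans ?_
    calc ∑ v, ‖x v • w v‖ ≤ ∑ v, x v * ε := Finset.sum_le_sum fun v _ => by
          rw [norm_smul, Real.norm_eq_abs, abs_of_nonneg (hx.1 v)]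
          exact mul_le_mul_of_nonneg_left (hw1 v) (hx.1 v)
      _ = ε := by rw [← Finset.sum_mul, hx.2.1, one_mul]
  · intro s hs t ht x y hx hy hxy
    apply hw2 s hs t ht x y hx hy
    by_contra! h
    exact hxy (funext fun v => h v (Finset.mem_univ v))


lemma inface_compact {N : ℕ} (s : Finset (Fin N)) : IsCompact {x : Fin N → ℝ | InFace s x} := by
  have e : {x : Fin N → ℝ | InFace s x} = stdSimplex ℝ (Fin N) ∩ ⋂ i, {x | i ∉ s → x i = 0} := by
    ext x
    simp only [InFace, stdSimplex, mem_inter_iff, mem_iInter, Set.mem_ofPred_eq, and_assoc]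
  rw [e]
  apply (isCompact_stdSimplex ℝ (Fin N)).inter_right
  apply isClosed_iInter
  intro i
  by_cases h : i ∈ s
  · simp [h]
  · simp only [h, not_false_eq_true, forall_true_left]
    exact isClosed_eq (continuous_apply i) continuous_const

lemma hull_weights {E : Type*} [NormedAddCommGroup E] [NormedSpace ℝ E] {N : ℕ} (em : Fin N ↪ E)
    (s : Finset (Fin N)) (x : E) :
    x ∈ convexHull ℝ ((s.map em : Finset E) : Set E) ↔
      ∃ w, InFace s w ∧ ∑ v, w v • em v = x := by
  constructor
  · intro hx
    rw [Finset.mem_convexHull'] at hx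
    obtain ⟨w, h1, h2, h3⟩ := hx
    rw [Finset.sum_map] at h2 h3
    refine ⟨fun i => if i ∈ s then w (em i) else 0, ⟨?_, ?_, ?_⟩, ?_⟩
    · intro i
      dsimp only
      split_ifs with h
      · exact h1 _ (Finset.mem_map_of_mem _ h)
      · exact le_rfl
    · rw [← h2]; simp
    · intro i hi; simp [hi]
    · rw [← h3]; simp [ite_smul]
  · rintro ⟨w, ⟨h1, h2, h3⟩, rfl⟩
    have e1 : ∑ v ∈ s, w v = 1 := by
      rw [← h2]; exact Finset.sum_subset (Finset.subset_univ _) fun i _ hi => h3 i hi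
    have e2 : ∑ v, w v • em v = ∑ v ∈ s, w v • em v := by
      symm
      exact Finset.sum_subset (Finset.subset_univ _) fun i _ hi => by rw [h3 i hi, zero_smul]
    rw [e2]
    exact (convex_convexHull ℝ _).sum_mem (fun i _ => h1 i) e1 fun i hi =>
      subset_convexHull ℝ _ (Finset.mem_coe.2 (Finset.mem_map_of_mem _ hi))

lemma weights_unique {E : Type*} [NormedAddCommGroup E] [NormedSpace ℝ E] {N : ℕ} (em : Fin N ↪ E)
    (X : Geometry.SimplicialComplex ℝ E) (s : Finset (Fin N)) (hs : s.map em ∈ X.faces)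
    (w w' : Fin N → ℝ) (hw : InFace s w) (hw' : InFace s w')
    (h : ∑ v, w v • em v = ∑ v, w' v • em v) : w = w' := by
  have hi := X.indep hs
  let f : {i // i ∈ s} ↪ {y // y ∈ s.map em} :=
    ⟨fun i => ⟨em i, Finset.mem_map_of_mem _ i.2⟩, fun a b hab => by
      simp only [Subtype.mk.injEq, EmbeddingLike.apply_eq_iff_eq] at hab
      exact Subtype.ext hab⟩
  have hi2 := affineIndependent_iff.1 (hi.comp_embedding f)
  have red : ∀ (w : Fin N → ℝ), InFace s w → ∑ v : {i // i ∈ s}, w v = 1 ∧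
      ∑ v : {i // i ∈ s}, w v • em v = ∑ v, w v • em v := by
    intro w hw
    rw [Finset.sum_coe_sort s w, Finset.sum_coe_sort s (fun v => w v • em v)]
    constructor
    · rw [← hw.2.1]; exact Finset.sum_subset (Finset.subset_univ _) fun i _ hi => hw.2.2 i hi
    · exact Finset.sum_subset (Finset.subset_univ _) fun i _ hi => by rw [hw.2.2 i hi, zero_smul]
  have r1 := red w hw
  have r2 := red w' hw'
  have hi3 := hi2 Finset.univ (fun v => w v - w' v)
    (by rw [Finset.sum_sub_distrib, r1.1, r2.1, sub_self])
    (by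
      change ∑ v : {i // i ∈ s}, (w v - w' v) • em v = 0
      simp only [sub_smul]
      rw [Finset.sum_sub_distrib, r1.2, r2.2, h, sub_self])
  funext v
  by_cases hv : v ∈ s
  · have := hi3 ⟨v, hv⟩ (Finset.mem_univ _)
    simp only at this
    linarith
  · rw [hw.2.2 v hv, hw'.2.2 v hv]

lemma bary {E : Type*} [NormedAddCommGroup E] [NormedSpace ℝ E] {N : ℕ} (em : Fin N ↪ E)
    (X : Geometry.SimplicialComplex ℝ E)
    (hex : ∀ s ∈ X.faces, ∃ s' : Finset (Fin N), s'.map em = s) :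
    ∃ h : X.space → Fin N → ℝ, Continuous h ∧ Injective h ∧
      (∀ x, ∃ s', s'.map em ∈ X.faces ∧ InFace s' (h x)) ∧
      ∀ s' : Finset (Fin N), s'.map em ∈ X.faces → ∀ x : X.space,
        (x : E) ∈ convexHull ℝ ((s'.map em : Finset E) : Set E) → InFace s' (h x) := by
  have uniq : ∀ s t : Finset (Fin N), s.map em ∈ X.faces → t.map em ∈ X.faces → ∀ w w',
      InFace s w → InFace t w' → ∑ v, w v • em v = ∑ v, w' v • em v → w = w' := by
    intro s t hs ht w w' hw hw' h
    have h1 : ∑ v, w v • em v ∈ convexHull ℝ ((s.map em : Finset E) : Set E) :=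
      (hull_weights em s _).2 ⟨w, hw, rfl⟩
    have h2 : ∑ v, w v • em v ∈ convexHull ℝ ((t.map em : Finset E) : Set E) :=
      (hull_weights em t _).2 ⟨w', hw', h.symm⟩
    have h3 := X.inter_subset_convexHull hs ht ⟨h1, h2⟩
    have e : ((s.map em : Finset E) : Set E) ∩ ((t.map em : Finset E) : Set E) =
        (((s ∩ t).map em : Finset E) : Set E) := by
      rw [Finset.coe_map, Finset.coe_map, Finset.coe_map, Finset.coe_inter,
        Set.image_inter em.injective]
    rw [e, hull_weights] at h3
    obtain ⟨w'', hw'', h4⟩ := h3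
    have i1 : InFace s w'' := ⟨hw''.1, hw''.2.1, fun i hi => hw''.2.2 i fun hi' =>
      hi (Finset.mem_inter.1 hi').1⟩
    have i2 : InFace t w'' := ⟨hw''.1, hw''.2.1, fun i hi => hw''.2.2 i fun hi' =>
      hi (Finset.mem_inter.1 hi').2⟩
    rw [weights_unique em X s hs w w'' hw i1 h4.symm, weights_unique em X t ht w' w'' hw' i2 (h.symm.trans h4.symm)]
  let F : Set (Finset (Fin N)) := {s | s.map em ∈ X.faces}
  let K : Set (Fin N → ℝ) := ⋃ s ∈ F, {x | InFace s x}
  have hK : IsCompact K := (Set.toFinite F).isCompact_biUnion fun s _ => inface_compact s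
  have hKm : ∀ w : K, ∃ s, s.map em ∈ X.faces ∧ InFace s w.1 := by
    intro w
    have := w.2
    simp only [K, mem_iUnion] at this
    obtain ⟨s, hs, hw⟩ := this
    exact ⟨s, hs, hw⟩
  have hKc : CompactSpace K := isCompact_iff_compactSpace.1 hK
  let b : K → X.space := fun w => ⟨∑ v, w.1 v • em v, by
    obtain ⟨s, hs, hw⟩ := hKm w
    rw [Geometry.SimplicialComplex.mem_space_iff]
    exact ⟨_, hs, (hull_weights em s _).2 ⟨w, hw, rfl⟩⟩⟩
  have hbc : Continuous b := by
    apply Continuous.subtype_mk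
    refine continuous_finsetSum _ fun v _ => ?_
    exact ((continuous_apply v).comp continuous_subtype_val).smul continuous_const
  have hbi : Injective b := by
    intro w w' h
    obtain ⟨s, hs, hw⟩ := hKm w
    obtain ⟨t, ht, hw'⟩ := hKm w'
    exact Subtype.ext (uniq s t hs ht _ _ hw hw' (congrArg Subtype.val h))
  have hbs : Surjective b := by
    intro x
    obtain ⟨s, hs, hx⟩ := Geometry.SimplicialComplex.mem_space_iff.1 x.2
    obtain ⟨s', rfl⟩ := hex s hs
    obtain ⟨w, hw, h⟩ := (hull_weights em s' _).1 hx
    refine ⟨⟨w, ?_⟩, Subtype.ext h⟩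
    simp only [K, mem_iUnion]
    exact ⟨s', hs, hw⟩
  let e := Equiv.ofBijective b ⟨hbi, hbs⟩
  have hec : Continuous e := hbc
  let H := hec.homeoOfEquivCompactToT2
  have hH : ∀ x, b (H.symm x) = x := fun x => H.apply_symm_apply x
  refine ⟨fun x => (H.symm x).1, continuous_subtype_val.comp H.symm.continuous,
    Subtype.val_injective.comp H.symm.injective, fun x => hKm _, ?_⟩
  intro s hs x hx
  obtain ⟨w, hw, h⟩ := (hull_weights em s _).1 hx
  obtain ⟨t, ht, hw'⟩ := hKm (H.symm x)
  have h2 : ∑ v, (H.symm x).1 v • em v = (x : E) := congrArg Subtype.val (hH x)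
  have := uniq s t hs ht w _ hw hw' (h.trans h2.symm)
  show InFace s (H.symm x).1
  rw [← this]
  exact hw

lemma euc_le {n : ℕ} (hn : 1 ≤ n) (x : Fin n → ℝ) (B : ℝ) (hB : ‖x‖ ≤ B) :
    ‖(WithLp.toLp 2 x : EuclideanSpace ℝ (Fin n))‖ ≤ n * B := by
  have hB0 : 0 ≤ B := (norm_nonneg _).trans hB
  have hn1 : (1 : ℝ) ≤ n := by exact_mod_cast hn
  rw [EuclideanSpace.norm_eq, Real.sqrt_le_left (by positivity)]
  have : ∀ i ∈ (Finset.univ : Finset (Fin n)), ‖x i‖ ^ 2 ≤ B ^ 2 := fun i _ =>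
    pow_le_pow_left₀ (norm_nonneg _) ((norm_le_pi_norm x i).trans hB) 2
  refine (Finset.sum_le_sum this).trans ?_
  simp only [Finset.sum_const, Finset.card_univ, Fintype.card_fin, nsmul_eq_mul]
  nlinarith [sq_nonneg B]

lemma euc_ge {n : ℕ} (x y : Fin n → ℝ) :
    ‖x - y‖ ≤ dist (WithLp.toLp 2 x : EuclideanSpace ℝ (Fin n)) (WithLp.toLp 2 y) := by
  rw [dist_eq_norm, pi_norm_le_iff_of_nonneg (norm_nonneg _)]
  intro i
  exact PiLp.norm_apply_le (WithLp.toLp 2 x - WithLp.toLp 2 y : EuclideanSpace ℝ (Fin n)) i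


theorem statement4 (k n L : ℕ) (hn : 2 * k + 1 ≤ n) (hL : 1 ≤ L) :
    ∃ C : ℝ, 0 < C ∧
      ∀ (E : Type) [NormedAddCommGroup E] [NormedSpace ℝ E]
        (X : Geometry.SimplicialComplex ℝ E) (N : ℕ),
        X.faces.Finite →
        (∀ s ∈ X.faces, s.card ≤ k + 1) →
        (∃ s ∈ X.faces, s.card = k + 1) →
        X.vertices.ncard = N → 2 ≤ N →
        (∀ v ∈ X.vertices, {s | s ∈ X.faces ∧ v ∈ s}.ncard ≤ L) →
        ∃ I : X.space → EuclideanSpace ℝ (Fin n),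
          Continuous I ∧ Function.Injective I ∧
          (∀ x, I x ∈ Metric.closedBall (0 : EuclideanSpace ℝ (Fin n))
            (C * (N : ℝ) ^ (((n : ℝ) - (k : ℝ))⁻¹) * Real.log N ^ (2 * k + 2))) ∧
          HasCombThickness X I 1 := by
  obtain ⟨C, hC, hasm⟩ := assembly k n L hn
  refine ⟨n * (C + 4 ^ (k + 1)), ?_, ?_⟩
  · have : (0 : ℝ) < n := by exact_mod_cast (by omega : 0 < n)
    positivity
  intro E _ _ X N hfin hdim _ hcard hN hdeg
  have hvfin : X.vertices.Finite := Set.finite_of_ncard_ne_zero (by omega)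
  have : Finite X.vertices := hvfin
  let e : Fin N ≃ X.vertices := (Finite.equivFinOfCardEq (by rw [← hcard]; rfl)).symm
  let em : Fin N ↪ E := e.toEmbedding.trans (Function.Embedding.subtype _)
  have hemv : ∀ i, em i ∈ X.vertices := fun i => (e i).2
  have hex : ∀ s ∈ X.faces, ∃ s' : Finset (Fin N), s'.map em = s := by
    intro s hs
    refine ⟨Finset.univ.filter (fun i => em i ∈ s), ?_⟩
    ext y
    simp only [Finset.mem_map, Finset.mem_filter, Finset.mem_univ, true_and]
    constructor
    · rintro ⟨i, hi, rfl⟩; exact hi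
    · intro hy
      have hyv : y ∈ X.vertices := Geometry.SimplicialComplex.mem_vertices.2
        (X.down_closed hs (Finset.singleton_subset_iff.2 hy) (Finset.singleton_nonempty y))
      have hy2 : em (e.symm ⟨y, hyv⟩) = y := by
        change ((e (e.symm ⟨y, hyv⟩) : X.vertices) : E) = y
        rw [e.apply_symm_apply]
      exact ⟨e.symm ⟨y, hyv⟩, by rw [hy2]; exact hy, hy2⟩
  obtain ⟨h, hc, hi, hin, hface⟩ := bary em X hex
  let F : Finset (Finset (Fin N)) := Finset.univ.filter (fun s => s.map em ∈ X.faces)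
  have hF : ∀ s, s ∈ F ↔ s.map em ∈ X.faces := fun s => by simp [F]
  have hne : ∀ s ∈ F, s.Nonempty := by
    intro s hs
    have := (X.isRelLowerSet_faces ((hF s).1 hs)).1
    simpa using this
  have hFk : ∀ s ∈ F, s.card ≤ k + 1 := by
    intro s hs
    have := hdim _ ((hF s).1 hs)
    rwa [Finset.card_map] at this
  have hFd : ∀ v, (F.filter (fun s => v ∈ s)).card ≤ L := by
    intro v
    refine le_trans ?_ (hdeg (em v) (hemv v))
    rw [← Set.ncard_coe_finset]
    refine Set.ncard_le_ncard_of_injOn (fun s => s.map em) ?_ ?_ (hfin.subset fun s hs => hs.1)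
    · intro s hs
      simp only [Finset.coe_filter, Set.mem_ofPred_eq] at hs ⊢
      exact ⟨(hF s).1 hs.1, Finset.mem_map_of_mem _ hs.2⟩
    · exact (Finset.map_injective em).injOn
  obtain ⟨g, Cl, hg1, hg2, hg3⟩ := hasm N hN F hne hFk hFd
  obtain ⟨g', hg'1, hg'2, hg'3⟩ := generic_inj k hn F hne hFk g Cl hg1 (1 / 2) (by norm_num)
  refine ⟨fun x => WithLp.toLp 2 (g' (h x)), ?_, ?_, ?_, ?_⟩
  · exact (PiLp.continuous_toLp 2 _).comp (hg'1.comp hc)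
  · intro x y hxy
    by_contra hne'
    obtain ⟨s, hs, hxs⟩ := hin x
    obtain ⟨t, ht, hyt⟩ := hin y
    exact hg'3 s ((hF s).2 hs) t ((hF t).2 ht) _ _ hxs hyt (fun h' => hne' (hi h'))
      (WithLp.toLp_injective 2 hxy)
  · intro x
    rw [mem_closedBall_zero_iff]
    obtain ⟨s, hs, hxs⟩ := hin x
    have b1 := hg2 s ((hF s).2 hs) _ hxs
    have b2 := hg'2 s _ hxs
    have hN1 : (1 : ℝ) ≤ (N : ℝ) ^ (((n : ℝ) - (k : ℝ))⁻¹) := by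
      apply Real.one_le_rpow
      · exact_mod_cast (by omega : 1 ≤ N)
      · apply inv_nonneg.2
        have : (k : ℝ) ≤ n := by exact_mod_cast (by omega : k ≤ n)
        linarith
    have hlog : (1 / 2 : ℝ) ≤ Real.log N := by
      have h1 : Real.log 2 ≤ Real.log N :=
        Real.log_le_log (by norm_num) (by exact_mod_cast hN)
      linarith [Real.log_two_gt_d9]
    have hlp : (1 / 2 : ℝ) ^ (2 * k + 2) ≤ Real.log N ^ (2 * k + 2) :=
      pow_le_pow_left₀ (by norm_num) hlog _
    have h4 : (4 : ℝ) ^ (k + 1) * (1 / 2 : ℝ) ^ (2 * k + 2) = 1 := by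
      rw [show 2 * k + 2 = 2 * (k + 1) by ring, pow_mul, ← mul_pow]
      norm_num
    set A := (N : ℝ) ^ (((n : ℝ) - (k : ℝ))⁻¹)
    set B := Real.log N ^ (2 * k + 2)
    have hB0 : 0 ≤ B := le_trans (by positivity) hlp
    have h5 : 1 ≤ (4 : ℝ) ^ (k + 1) * A * B := by
      calc (1 : ℝ) = (4 : ℝ) ^ (k + 1) * 1 * (1 / 2 : ℝ) ^ (2 * k + 2) := by rw [mul_one, h4]
        _ ≤ _ := by
          apply mul_le_mul _ hlp (by positivity) (by positivity)
          exact mul_le_mul_of_nonneg_left hN1 (by positivity)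
    have b3 : ‖g' (h x)‖ ≤ (C + 4 ^ (k + 1)) * A * B := by
      calc ‖g' (h x)‖ = ‖g (h x) + (g' (h x) - g (h x))‖ := by congr 1; abel
        _ ≤ ‖g (h x)‖ + ‖g' (h x) - g (h x)‖ := norm_add_le _ _
        _ ≤ C * A * B + 1 / 2 := add_le_add b1 b2
        _ ≤ C * A * B + (4 : ℝ) ^ (k + 1) * A * B := by linarith
        _ = _ := by ring
    refine (euc_le (by omega) _ _ b3).trans (le_of_eq ?_)
    ring
  · intro s hs t ht hdj x y hx hy
    obtain ⟨s', rfl⟩ := hex s hs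
    obtain ⟨t', rfl⟩ := hex t ht
    have hxs := hface s' hs x hx
    have hyt := hface t' ht y hy
    have hdj' : Disjoint s' t' := (Finset.disjoint_map em).1 hdj
    have h1 := hg3 s' ((hF s').2 hs) t' ((hF t').2 ht) hdj' _ _ hxs hyt
    have h2 := hg'2 s' _ hxs
    have h3 := hg'2 t' _ hyt
    refine le_trans ?_ (euc_ge _ _)
    have h4 : ‖g (h x) - g (h y)‖ ≤ ‖g' (h x) - g' (h y)‖ + ‖g' (h x) - g (h x)‖ +
        ‖g' (h y) - g (h y)‖ := by
      calc ‖g (h x) - g (h y)‖ = ‖(g' (h x) - g' (h y)) - (g' (h x) - g (h x)) + (g' (h y) - g (h y))‖ := by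
            congr 1; abel
        _ ≤ ‖(g' (h x) - g' (h y)) - (g' (h x) - g (h x))‖ + ‖g' (h y) - g (h y)‖ := norm_add_le _ _
        _ ≤ _ := add_le_add (norm_sub_le _ _) le_rfl
    linarith
end

section
/- Let k ≥ 0 and n ≥ 2k+1. There is a constant c(n) > 0 with the following property: let V be a finite set and let F be a family of subsets of V, each of cardinality at most k+1, with |F| = N ≥ 2, and let R > 0. If points (p_v)_{v∈V} in ℝⁿ are chosen independently, each uniformly at random from the closed ball of radius R centered at the origin, then with probability at least 1/2 the following holds: for every pair of sets s, t ∈ F with s ∩ t = ∅, the Euclidean distance between convexHull{p_v : v ∈ s} and convexHull{p_v : v ∈ t} is at least c(n)·R·N^{−2/(n−2k)}. -/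
open scoped Classical
open Metric Set Function MeasureTheory

lemma hull_weights_s5 {V : Type} [Fintype V] {E : Type*} [NormedAddCommGroup E] [NormedSpace ℝ E]
    (p : V → E) (s : Finset V) {x : E} (hx : x ∈ convexHull ℝ (p '' (s : Set V))) :
    ∃ w : V → ℝ, (∀ v, 0 ≤ w v) ∧ (∀ v, v ∉ s → w v = 0) ∧ ∑ v, w v = 1 ∧
      ∑ v, w v • p v = x := by
  have key : convexHull ℝ (p '' (s : Set V)) ⊆ {x | ∃ w : V → ℝ, (∀ v, 0 ≤ w v) ∧
      (∀ v, v ∉ s → w v = 0) ∧ ∑ v, w v = 1 ∧ ∑ v, w v • p v = x} := by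
    apply convexHull_min
    · rintro _ ⟨v, hv, rfl⟩
      refine ⟨Pi.single v 1, ?_, ?_, ?_, ?_⟩
      · intro u
        by_cases h : u = v
        · subst h; simp
        · simp [h]
      · intro u hu
        have : u ≠ v := by rintro rfl; exact hu hv
        simp [this]
      · simp
      · simp [Pi.single_apply]
    · rintro _ ⟨w, h0, h1, h2, rfl⟩ _ ⟨w', h0', h1', h2', rfl⟩ a b ha hb hab
      refine ⟨fun v => a * w v + b * w' v, ?_, ?_, ?_, ?_⟩
      · intro v
        have := h0 v
        have := h0' v
        positivity
      · intro v hv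
        simp [h1 v hv, h1' v hv]
      · rw [Finset.sum_add_distrib, ← Finset.mul_sum, ← Finset.mul_sum, h2, h2']; simpa using hab
      · simp_rw [add_smul, mul_smul]
        rw [Finset.sum_add_distrib, ← Finset.smul_sum, ← Finset.smul_sum]
  exact key hx

/-- basis adapted to a subspace -/
lemma adapted_basis (n d : ℕ) (hd : d ≤ n) (W : Submodule ℝ (EuclideanSpace ℝ (Fin n)))
    (hW : Module.finrank ℝ W ≤ d) :
    ∃ b : OrthonormalBasis (Fin n) ℝ (EuclideanSpace ℝ (Fin n)),
      ∀ i : Fin n, d ≤ (i : ℕ) → b i ∈ Wᗮ := by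
  have hfr : Module.finrank ℝ W + Module.finrank ℝ Wᗮ = n := by
    rw [Submodule.finrank_add_finrank_orthogonal]; simp
  let o := stdOrthonormalBasis ℝ Wᗮ
  let v : Fin n → EuclideanSpace ℝ (Fin n) := fun i =>
    if h : (i : ℕ) - d < Module.finrank ℝ Wᗮ then (o ⟨(i : ℕ) - d, h⟩ : EuclideanSpace ℝ (Fin n))
    else 0
  let s : Set (Fin n) := {i | d ≤ (i : ℕ)}
  have hlt : ∀ i ∈ s, (i : ℕ) - d < Module.finrank ℝ Wᗮ := by
    intro i hi
    have h1 : d ≤ (i : ℕ) := hi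
    have := i.2
    omega
  have hv : Orthonormal ℝ (s.domRestrict v) := by
    have ho : Orthonormal ℝ (fun j => (o j : EuclideanSpace ℝ (Fin n))) :=
      o.orthonormal.comp_linearIsometry Wᗮ.subtypeₗᵢ
    have := ho.comp (fun i : s => (⟨(i.1 : ℕ) - d, hlt i.1 i.2⟩ : Fin (Module.finrank ℝ Wᗮ)))
      (by
        rintro ⟨i, hi⟩ ⟨j, hj⟩ hij
        have h1 : d ≤ (i : ℕ) := hi
        have h2 : d ≤ (j : ℕ) := hj
        simp only [Fin.mk.injEq] at hij
        ext
        simp only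
        omega)
    convert this using 1
    funext i
    simp [v, Set.domRestrict, hlt i.1 i.2]
  obtain ⟨b, hb⟩ := hv.exists_orthonormalBasis_extension_of_card_eq (by simp)
  refine ⟨b, fun i hi => ?_⟩
  rw [hb i hi]
  simp only [v, dif_pos (hlt i hi)]
  exact (o _).2

lemma slab_volume (n d : ℕ) (hd : d ≤ n) (W : Submodule ℝ (EuclideanSpace ℝ (Fin n)))
    (hW : Module.finrank ℝ W ≤ d) (q : EuclideanSpace ℝ (Fin n)) (R δ : ℝ) (hR : 0 ≤ R)
    (hδ : 0 ≤ δ) :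
    volume ({x : EuclideanSpace ℝ (Fin n) | ∃ w ∈ W, ‖x - q + w‖ < δ} ∩ closedBall 0 R) ≤
      ENNReal.ofReal ((2 * R) ^ d * (2 * δ) ^ (n - d)) := by
  obtain ⟨b, hb⟩ := adapted_basis n d hd W hW
  let lo : Fin n → ℝ := fun i => if (i : ℕ) < d then -R else inner ℝ (b i) q - δ
  let hi : Fin n → ℝ := fun i => if (i : ℕ) < d then R else inner ℝ (b i) q + δ
  have hmp := (EuclideanSpace.volume_preserving_symm_measurableEquiv_toLp (Fin n)).comp
    b.measurePreserving_repr
  have hsub : ({x : EuclideanSpace ℝ (Fin n) | ∃ w ∈ W, ‖x - q + w‖ < δ} ∩ closedBall 0 R) ⊆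
      ((MeasurableEquiv.toLp 2 (Fin n → ℝ)).symm ∘ b.repr) ⁻¹' (Icc lo hi) := by
    rintro x ⟨⟨w, hw, hxw⟩, hxR⟩
    have hx : ∀ i, ((MeasurableEquiv.toLp 2 (Fin n → ℝ)).symm ∘ b.repr) x i = inner ℝ (b i) x := by
      intro i
      simp [OrthonormalBasis.repr_apply_apply]
    have main : ∀ i, lo i ≤ inner ℝ (b i) x ∧ inner ℝ (b i) x ≤ hi i := by
      intro i
      by_cases h : (i : ℕ) < d
      · simp only [lo, hi, if_pos h]
        have h1 := abs_real_inner_le_norm (b i) x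
        rw [b.norm_eq_one, one_mul] at h1
        have h2 : ‖x‖ ≤ R := by simpa using hxR
        exact abs_le.mp (h1.trans h2)
      · simp only [lo, hi, if_neg h]
        have h1 := abs_real_inner_le_norm (b i) (x - q + w)
        have h3 : inner ℝ (b i) w = 0 := by
          rw [real_inner_comm]
          exact hb i (not_lt.mp h) w hw
        rw [b.norm_eq_one, one_mul, inner_add_right, inner_sub_right, h3, add_zero] at h1
        have := abs_le.mp (h1.trans hxw.le)
        constructor <;> linarith [this.1, this.2]
    exact ⟨fun i => by rw [hx]; exact (main i).1, fun i => by rw [hx]; exact (main i).2⟩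
  refine (measure_mono hsub).trans ?_
  rw [hmp.measure_preimage measurableSet_Icc.nullMeasurableSet, Real.volume_Icc_pi,
    ← ENNReal.ofReal_prod_of_nonneg]
  · apply ENNReal.ofReal_le_ofReal
    have : ∀ i : Fin n, hi i - lo i = if (i : ℕ) < d then 2 * R else 2 * δ := by
      intro i
      simp only [hi, lo]
      split_ifs <;> ring
    simp_rw [this]
    rw [Fin.prod_univ_eq_prod_range (fun i => if i < d then 2 * R else 2 * δ) n,
      ← Finset.prod_range_mul_prod_Ico _ hd]
    rw [Finset.prod_congr rfl (g := fun _ => 2 * R), Finset.prod_congr (s₁ := Finset.Ico d n) rfl (g := fun _ => 2 * δ)]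
    · simp
    · intro i hi
      simp only [Finset.mem_Ico] at hi
      rw [if_neg (by omega)]
    · intro i hi
      rw [if_pos (by simpa using hi)]
  · intro i _
    simp only [hi, lo]
    split_ifs <;> linarith

/-- The bad event. -/
def badSet {V : Type} [Fintype V] (n : ℕ) (T : Finset V) (i : V) (δ : ℝ) :
    Set (V → EuclideanSpace ℝ (Fin n)) :=
  {p | ∃ a : V → ℝ, (a i = 1 ∧ (∀ v, v ∉ T → a v = 0) ∧ ∑ v, a v = 0) ∧ ‖∑ v, a v • p v‖ < δ}

lemma badSet_open {V : Type} [Fintype V] (n : ℕ) (T : Finset V) (i : V) (δ : ℝ) :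
    IsOpen (badSet n T i δ) := by
  have : badSet n T i δ = ⋃ (a : V → ℝ) (_ : a i = 1 ∧ (∀ v, v ∉ T → a v = 0) ∧ ∑ v, a v = 0),
      {p : V → EuclideanSpace ℝ (Fin n) | ‖∑ v, a v • p v‖ < δ} := by
    ext p
    simp only [badSet, Set.mem_iUnion, exists_prop]
    rfl
  rw [this]
  refine isOpen_iUnion fun a => isOpen_iUnion fun _ => ?_
  exact isOpen_lt (by fun_prop) continuous_const

lemma badSet_section {V : Type} [Fintype V] (n d : ℕ) (T : Finset V) (i : V) (δ : ℝ)
    (hT : T.card ≤ d + 2) (hi : i ∈ T) (p : V → EuclideanSpace ℝ (Fin n)) :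
    ∃ (W : Submodule ℝ (EuclideanSpace ℝ (Fin n))) (q : EuclideanSpace ℝ (Fin n)),
      Module.finrank ℝ W ≤ d ∧
      ∀ x, Function.update p i x ∈ badSet n T i δ → ∃ w ∈ W, ‖x - q + w‖ < δ := by
  by_cases hj : ∃ j ∈ T, j ≠ i
  · obtain ⟨j, hjT, hji⟩ := hj
    let S : Finset V := (T.erase i).erase j
    have hjS : j ∈ T.erase i := Finset.mem_erase.2 ⟨hji, hjT⟩
    have hS : S.card ≤ d := by
      have h1 := Finset.card_erase_of_mem hjS
      have h2 := Finset.card_erase_of_mem hi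
      simp only [S]
      omega
    refine ⟨Submodule.span ℝ ((S.image fun v => p v - p j : Finset _) : Set _), p j, ?_, ?_⟩
    · exact (finrank_span_finset_le_card _).trans (Finset.card_image_le.trans hS)
    · rintro x ⟨a, ⟨hai, haT, hsum⟩, hlt⟩
      refine ⟨∑ v ∈ S, a v • (p v - p j), ?_, ?_⟩
      · refine Submodule.sum_mem _ fun v hv => Submodule.smul_mem _ _ (Submodule.subset_span ?_)
        exact Finset.mem_coe.2 (Finset.mem_image_of_mem _ hv)
      · convert hlt using 2
        have e1 : ∑ v, a v = 1 + (a j + ∑ v ∈ S, a v) := by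
          rw [← Finset.sum_subset (Finset.subset_univ T) (fun v _ hv => haT v hv),
            ← Finset.add_sum_erase _ _ hi, ← Finset.add_sum_erase _ _ hjS, hai]
        have e2 : ∑ v, a v • Function.update p i x v = x + (a j • p j + ∑ v ∈ S, a v • p v) := by
          rw [← Finset.sum_subset (Finset.subset_univ T) (fun v _ hv => by simp [haT v hv]),
            ← Finset.add_sum_erase _ _ hi, ← Finset.add_sum_erase _ _ hjS, hai]
          simp only [Function.update_self, one_smul, Function.update_of_ne hji]
          congr 2
          refine Finset.sum_congr rfl fun v hv => ?_
          have : v ≠ i := (Finset.mem_erase.1 (Finset.mem_erase.1 hv).2).1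
          rw [Function.update_of_ne this]
        have e3 : a j = -1 - ∑ v ∈ S, a v := by linarith
        rw [e2, e3]
        simp_rw [smul_sub]
        rw [Finset.sum_sub_distrib, ← Finset.sum_smul, sub_smul, neg_smul, one_smul]
        abel
  · push Not at hj
    refine ⟨⊥, 0, by simp, ?_⟩
    rintro x ⟨a, ⟨hai, haT, hsum⟩, hlt⟩
    exfalso
    rw [Finset.sum_eq_single i (fun v _ hv => haT v fun h => hv (hj v h)) (by simp), hai] at hsum
    exact one_ne_zero hsum

lemma badSet_measure {V : Type} [Fintype V] (n d : ℕ) (hd : d ≤ n) (T : Finset V) (i : V) (R δ : ℝ)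
    (hR : 0 < R) (hδ : 0 ≤ δ) (hT : T.card ≤ d + 2) (hi : i ∈ T) (D : ENNReal)
    (hD : ENNReal.ofReal ((2 * R) ^ d * (2 * δ) ^ (n - d)) ≤
      D * volume (closedBall (0 : EuclideanSpace ℝ (Fin n)) R)) :
    (Measure.pi fun _ : V =>
            volume.restrict (Metric.closedBall (0 : EuclideanSpace ℝ (Fin n)) R)) (badSet n T i δ) ≤
      D * (Measure.pi fun _ : V =>
            volume.restrict (Metric.closedBall (0 : EuclideanSpace ℝ (Fin n)) R)) univ := by
  have hm := (badSet_open n T i δ).measurableSet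
  have := lintegral_le_of_lmarginal_le (μ := fun _ : V =>
            volume.restrict (Metric.closedBall (0 : EuclideanSpace ℝ (Fin n)) R)) {i}
            (f := (badSet n T i δ).indicator 1) (g := fun _ => D)
            (measurable_one.indicator hm) measurable_const (by
      rw [lmarginal_singleton, lmarginal_singleton]
      intro p
      obtain ⟨W, q, hW, hsec⟩ := badSet_section n d T i δ hT hi p
      simp only [lintegral_const, Measure.restrict_apply_univ]
      refine le_trans ?_ ((slab_volume n d hd W hW q R δ hR.le hδ).trans hD)
      have hpre : MeasurableSet ((fun x => Function.update p i x) ⁻¹' (badSet n T i δ)) :=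
        (measurable_update p) hm
      have : (fun x => (badSet n T i δ).indicator (1 : (V → EuclideanSpace ℝ (Fin n)) → ENNReal) (Function.update p i x)) =
          ((fun x => Function.update p i x) ⁻¹' (badSet n T i δ)).indicator 1 := by
        ext x; simp [Set.indicator]
      rw [this, lintegral_indicator_one hpre, Measure.restrict_apply hpre]
      exact measure_mono (Set.inter_subset_inter_left _ fun x hx => hsec x hx))
  rwa [lintegral_indicator_one hm, lintegral_const] at this

lemma hull_bad {V : Type} [Fintype V] (n k : ℕ) (s t : Finset V) (hs : s.card ≤ k + 1)
    (hst : Disjoint s t) (p : V → EuclideanSpace ℝ (Fin n)) (ε : ℝ) (hε : 0 ≤ ε)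
    (x y) (hx : x ∈ convexHull ℝ (p '' (s : Set V))) (hy : y ∈ convexHull ℝ (p '' (t : Set V)))
    (hxy : dist x y < ε) : ∃ i ∈ s, p ∈ badSet n (s ∪ t) i ((k + 1) * ε) := by
  obtain ⟨w, w0, w1, w2, w3⟩ := hull_weights_s5 p s hx
  obtain ⟨u, u0, u1, u2, u3⟩ := hull_weights_s5 p t hy
  have hws : ∑ v ∈ s, w v = 1 := by
    rw [← w2]; exact Finset.sum_subset (Finset.subset_univ s) (fun v _ hv => w1 v hv)
  have hne : s.Nonempty := by
    rw [Finset.nonempty_iff_ne_empty]; rintro rfl; simp at hws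
  obtain ⟨i, his, hi⟩ : ∃ i ∈ s, (1 : ℝ) / (k + 1) ≤ w i := by
    apply Finset.exists_le_of_sum_le hne
    rw [hws, Finset.sum_const, nsmul_eq_mul, mul_one_div, div_le_one (by positivity)]
    exact_mod_cast hs
  have hk : (0 : ℝ) < k + 1 := by positivity
  have hpos : 0 < w i := lt_of_lt_of_le (by positivity) hi
  have hui : u i = 0 := u1 i (Finset.disjoint_left.1 hst his)
  refine ⟨i, his, fun v => (w i)⁻¹ * (w v - u v), ⟨?_, ?_, ?_⟩, ?_⟩
  · show (w i)⁻¹ * (w i - u i) = 1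
    rw [hui, sub_zero, inv_mul_cancel₀ hpos.ne']
  · intro v hv
    rw [Finset.mem_union, not_or] at hv
    simp [w1 v hv.1, u1 v hv.2]
  · rw [← Finset.mul_sum, Finset.sum_sub_distrib, w2, u2]; simp
  · simp_rw [mul_smul]
    rw [← Finset.smul_sum]
    simp_rw [sub_smul]
    rw [Finset.sum_sub_distrib, w3, u3, norm_smul, ← dist_eq_norm, norm_inv, Real.norm_of_nonneg hpos.le]
    have h1 : (w i)⁻¹ ≤ k + 1 := by
      rw [inv_le_comm₀ hpos hk]; simpa using hi
    calc (w i)⁻¹ * dist x y ≤ (k + 1) * dist x y := by gcongr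
      _ < (k + 1) * ε := by gcongr

theorem statement5 (k n : ℕ) (hn : 2 * k + 1 ≤ n) :
    ∃ c : ℝ, 0 < c ∧
      ∀ (V : Type) [Fintype V] (F : Finset (Finset V)) (N : ℕ) (R : ℝ),
        (∀ s ∈ F, s.card ≤ k + 1) → F.card = N → 2 ≤ N → 0 < R →
        (Measure.pi fun _ : V =>
            volume.restrict (Metric.closedBall (0 : EuclideanSpace ℝ (Fin n)) R))
          Set.univ ≤
        2 * (Measure.pi fun _ : V =>
            volume.restrict (Metric.closedBall (0 : EuclideanSpace ℝ (Fin n)) R))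
          {p : V → EuclideanSpace ℝ (Fin n) |
            ∀ s ∈ F, ∀ t ∈ F, Disjoint s t →
              ∀ x ∈ convexHull ℝ (p '' (s : Set V)), ∀ y ∈ convexHull ℝ (p '' (t : Set V)),
                c * R * (N : ℝ) ^ (-2 / ((n : ℝ) - 2 * (k : ℝ))) ≤ dist x y} := by
  set E := EuclideanSpace ℝ (Fin n)
  have hVfin : volume (closedBall (0 : E) 1) ≠ ⊤ := measure_closedBall_lt_top.ne
  obtain ⟨B, hB⟩ : ∃ B : ℝ, B = (volume (closedBall (0 : E) 1)).toReal := ⟨_, rfl⟩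
  have hBv : volume (closedBall (0 : E) 1) = ENNReal.ofReal B := by
    rw [hB, ENNReal.ofReal_toReal hVfin]
  have hBpos : 0 < B := by
    rw [hB]; exact ENNReal.toReal_pos (measure_closedBall_pos _ _ one_pos).ne' hVfin
  have hk : (0 : ℝ) < k + 1 := by positivity
  -- `e = (k+1) c`
  obtain ⟨e, he⟩ : ∃ e : ℝ, e = min 1 (B / (2 ^ (n + 1) * (k + 1))) := ⟨_, rfl⟩
  have hepos : 0 < e := by rw [he]; exact lt_min one_pos (by positivity)
  have he1 : e ≤ 1 := by rw [he]; exact min_le_left _ _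
  have heB : 2 * (k + 1) * (2 ^ n * e) ≤ B := by
    have : e ≤ B / (2 ^ (n + 1) * (k + 1)) := by rw [he]; exact min_le_right _ _
    rw [le_div_iff₀ (by positivity)] at this
    calc _ = e * (2 ^ (n + 1) * (k + 1)) := by ring
      _ ≤ B := this
  refine ⟨e / (k + 1), by positivity, ?_⟩
  intro V _ F N R hF hFN hN hR
  set μ := (Measure.pi fun _ : V => volume.restrict (Metric.closedBall (0 : E) R)) with hμ
  have hNpos : (0 : ℝ) < N := by exact_mod_cast (by omega : 0 < N)
  set r : ℝ := (N : ℝ) ^ (-2 / ((n : ℝ) - 2 * (k : ℝ))) with hr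
  have hrpos : 0 < r := Real.rpow_pos_of_pos hNpos _
  have hrpow : r ^ (n - 2 * k) * (N : ℝ) ^ 2 = 1 := by
    have h1 : ((n - 2 * k : ℕ) : ℝ) = (n : ℝ) - 2 * k := by
      rw [Nat.cast_sub (by omega)]; push_cast; ring
    have h2 : (0 : ℝ) < (n : ℝ) - 2 * k := by
      rw [← h1]; exact_mod_cast (by omega : 0 < n - 2 * k)
    rw [hr, ← Real.rpow_natCast, ← Real.rpow_mul hNpos.le, h1, div_mul_cancel₀ _ h2.ne',
      ← Real.rpow_natCast, ← Real.rpow_add hNpos]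
    norm_num
  set ε : ℝ := e / (k + 1) * R * r with hε
  have hεpos : 0 < ε := by positivity
  have hδ : (k + 1) * ε = e * R * r := by rw [hε]; field_simp
  obtain ⟨D, hD⟩ : ∃ D : ℝ, D = (2 * (k + 1) * (N : ℝ) ^ 2)⁻¹ := ⟨_, rfl⟩
  have hDpos : 0 < D := by rw [hD]; positivity
  have hDbound : ENNReal.ofReal ((2 * R) ^ (2 * k) * (2 * ((k + 1) * ε)) ^ (n - 2 * k)) ≤
      ENNReal.ofReal D * volume (closedBall (0 : E) R) := by
    rw [Measure.addHaar_closedBall' _ _ hR.le, hBv, ← ENNReal.ofReal_mul (by positivity),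
      ← ENNReal.ofReal_mul hDpos.le]
    apply ENNReal.ofReal_le_ofReal
    have hfr : Module.finrank ℝ E = n := by simp [E]
    rw [hfr, hδ]
    have hem : e ^ (n - 2 * k) ≤ e := pow_le_of_le_one hepos.le he1 (by omega)
    have hrD : r ^ (n - 2 * k) = 2 * (k + 1) * D := by
      rw [hD]; field_simp; exact hrpow
    have hsplit : ∀ z : ℝ, z ^ (2 * k) * z ^ (n - 2 * k) = z ^ n := by
      intro z; rw [← pow_add]; congr 1; omega
    calc (2 * R) ^ (2 * k) * (2 * (e * R * r)) ^ (n - 2 * k)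
        = ((2 * R) ^ (2 * k) * (2 * R) ^ (n - 2 * k)) * e ^ (n - 2 * k) * r ^ (n - 2 * k) := by
          rw [show 2 * (e * R * r) = (2 * R) * e * r by ring, mul_pow (2 * R * e), mul_pow (2 * R) e]
          ring
      _ = 2 ^ n * R ^ n * e ^ (n - 2 * k) * (2 * (k + 1) * D) := by
          rw [hsplit, hrD, mul_pow]
      _ ≤ 2 ^ n * R ^ n * e * (2 * (k + 1) * D) := by gcongr
      _ = D * R ^ n * (2 * (k + 1) * (2 ^ n * e)) := by ring
      _ ≤ D * R ^ n * B := by gcongr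
      _ = D * (R ^ n * B) := by ring
  set G : Set (V → E) := {p : V → E |
            ∀ s ∈ F, ∀ t ∈ F, Disjoint s t →
              ∀ x ∈ convexHull ℝ (p '' (s : Set V)), ∀ y ∈ convexHull ℝ (p '' (t : Set V)),
                ε ≤ dist x y} with hG
  let U : Set (V → E) := ⋃ s ∈ F, ⋃ t ∈ F, ⋃ i ∈ s, badSet n (s ∪ t) i ((k + 1) * ε)
  have hcover : univ ⊆ U ∪ G := by
    intro p _
    by_cases hp : p ∈ U
    · exact Or.inl hp
    · right
      intro s hs t ht hst x hx y hy
      by_contra hlt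
      obtain ⟨i, hi, hbad⟩ := hull_bad n k s t (hF s hs) hst p ε hεpos.le x y hx hy (not_le.1 hlt)
      apply hp
      simp only [U, Set.mem_iUnion]
      exact ⟨s, hs, t, ht, i, hi, hbad⟩
  have hbadm : ∀ s ∈ F, ∀ t ∈ F, ∀ i ∈ s, μ (badSet n (s ∪ t) i ((k + 1) * ε)) ≤
      ENNReal.ofReal D * μ univ := by
    intro s hs t ht i hi
    refine badSet_measure n (2 * k) (by omega) (s ∪ t) i R _ hR (by positivity) ?_
      (Finset.mem_union_left _ hi) _ hDbound
    have h1 := Finset.card_union_le s t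
    have h2 := hF s hs
    have h3 := hF t ht
    omega
  have hU : μ U ≤ (N * (N * (k + 1)) : ENNReal) * (ENNReal.ofReal D * μ univ) := by
    calc μ U ≤ ∑ s ∈ F, ∑ t ∈ F, ∑ i ∈ s, μ (badSet n (s ∪ t) i ((k + 1) * ε)) := by
          refine (measure_biUnion_finset_le _ _).trans (Finset.sum_le_sum fun s _ => ?_)
          refine (measure_biUnion_finset_le _ _).trans (Finset.sum_le_sum fun t _ => ?_)
          exact measure_biUnion_finset_le _ _
      _ ≤ ∑ s ∈ F, ∑ t ∈ F, ((k + 1 : ℕ) : ENNReal) * (ENNReal.ofReal D * μ univ) := by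
          refine Finset.sum_le_sum fun s hs => Finset.sum_le_sum fun t ht => ?_
          refine (Finset.sum_le_card_nsmul _ _ _ (hbadm s hs t ht)).trans ?_
          rw [nsmul_eq_mul]
          gcongr
          exact hF s hs
      _ = _ := by
          simp only [Finset.sum_const, hFN, nsmul_eq_mul]
          push_cast
          ring
  have hU2 : 2 * μ U ≤ μ univ := by
    calc 2 * μ U ≤ 2 * ((N * (N * (k + 1)) : ENNReal) * (ENNReal.ofReal D * μ univ)) := by gcongr
      _ = (ENNReal.ofReal (2 * (N * (N * (k + 1))) * D)) * μ univ := by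
          rw [ENNReal.ofReal_mul (by positivity), ENNReal.ofReal_mul (by positivity),
            ENNReal.ofReal_mul (by positivity), ENNReal.ofReal_mul (by positivity),
            ENNReal.ofReal_add (by positivity) (by positivity)]
          simp only [ENNReal.ofReal_natCast, ENNReal.ofReal_one, ENNReal.ofReal_ofNat]
          ring
      _ = μ univ := by
          have : 2 * (N * (N * (k + 1))) * D = 1 := by rw [hD]; field_simp
          rw [this, ENNReal.ofReal_one, one_mul]
  have hfin : μ univ ≠ ⊤ := by
    rw [hμ, Measure.pi_univ]
    refine ENNReal.prod_ne_top fun i _ => ?_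
    rw [Measure.restrict_apply_univ]
    exact measure_closedBall_lt_top.ne
  have htot : μ univ ≤ μ U + μ G := (measure_mono hcover).trans (measure_union_le _ _)
  have : μ univ + μ univ ≤ μ univ + 2 * μ G := by
    calc μ univ + μ univ = 2 * μ univ := (two_mul _).symm
      _ ≤ 2 * (μ U + μ G) := by gcongr
      _ = 2 * μ U + 2 * μ G := mul_add _ _ _
      _ ≤ μ univ + 2 * μ G := by gcongr
  exact (ENNReal.add_le_add_iff_left hfin).1 this
end

section
/- Let X and X' be finite simplicial complexes in a real vector space such that X' is a refinement of X, meaning that |X'| = |X| and the convex hull of every face of X' is contained in the convex hull of some face of X. Let I : |X| → ℝⁿ be a topological embedding and let T > 0. If for every two faces s', t' of X' with s' ∩ t' = ∅ the Euclidean distance between I(convexHull s') and I(convexHull t') is at least T, then for every two faces s, t of X with s ∩ t = ∅ the Euclidean distance between I(convexHull s) and I(convexHull t) is at least T. In other words, the combinatorial thickness of I with respect to the refinement X' is at most its combinatorial thickness with respect to X. -/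
open scoped Classical
open Metric Set Function

/-- Refinement: a point of `conv s` lies in a face of the refinement inside `conv s`. -/
theorem aux_carrier {E : Type*} [NormedAddCommGroup E] [NormedSpace ℝ E]
    (X X' : Geometry.SimplicialComplex ℝ E)
    (hspace : X'.space = X.space)
    (href : ∀ s' ∈ X'.faces, ∃ s ∈ X.faces,
      convexHull ℝ (s' : Set E) ⊆ convexHull ℝ (s : Set E))
    (s : Finset E) (hs : s ∈ X.faces) (x : E) (hx : x ∈ convexHull ℝ (s : Set E)) :
    ∃ s' ∈ X'.faces, x ∈ convexHull ℝ (s' : Set E) ∧ (s' : Set E) ⊆ convexHull ℝ (s : Set E) := by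
  have hxX : x ∈ X'.space := hspace ▸ X.convexHull_subset_space hs hx
  obtain ⟨r, hr, hxr⟩ := Geometry.SimplicialComplex.mem_space_iff.1 hxX
  obtain ⟨u, hu, hru⟩ := href r hr
  have hxi := X.inter_subset_convexHull hs hu ⟨hx, hru hxr⟩
  rw [← Finset.coe_inter] at hxi
  obtain ⟨w, hw0, hw1, hwx⟩ := Finset.mem_convexHull'.1 hxr
  obtain ⟨d, hd0, hd1, hdx⟩ := Finset.mem_convexHull'.1 hxi
  have hc : ∀ v : E, ∃ c : E → ℝ, v ∈ r →
      (∀ a ∈ u, 0 ≤ c a) ∧ ∑ a ∈ u, c a = 1 ∧ ∑ a ∈ u, c a • a = v := by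
    intro v
    by_cases hv : v ∈ r
    · obtain ⟨c, hc⟩ := Finset.mem_convexHull'.1 (hru (subset_convexHull ℝ _ hv))
      exact ⟨c, fun _ => hc⟩
    · exact ⟨0, fun h => absurd h hv⟩
  choose c hc using hc
  let e : E → ℝ := fun a => if a ∈ s then d a else 0
  have he1 : ∑ a ∈ u, e a = 1 := by
    rw [← hd1, Finset.inter_comm, ← Finset.filter_mem_eq_inter, Finset.sum_filter]
  have hex : ∑ a ∈ u, e a • a = x := by
    rw [← hdx, Finset.inter_comm, ← Finset.filter_mem_eq_inter, Finset.sum_filter]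
    refine Finset.sum_congr rfl fun a _ => ?_
    simp only [e]; split_ifs <;> simp
  have hf1 : ∑ a ∈ u, ∑ v ∈ r, w v * c v a = 1 := by
    rw [Finset.sum_comm, ← hw1]
    refine Finset.sum_congr rfl fun v hv => ?_
    rw [← Finset.mul_sum, (hc v hv).2.1, mul_one]
  have hfx : ∑ a ∈ u, (∑ v ∈ r, w v * c v a) • a = x := by
    simp_rw [Finset.sum_smul]
    rw [Finset.sum_comm, ← hwx]
    refine Finset.sum_congr rfl fun v hv => ?_
    simp_rw [mul_smul]
    rw [← Finset.smul_sum, (hc v hv).2.2]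
  have hz : ∀ a ∈ u, ∑ v ∈ r, w v * c v a = e a := by
    have h := affineIndependent_iff.1 (X.indep hu) Finset.univ
      (fun a => (∑ v ∈ r, w v * c v a) - e a)
      (by
        rw [Finset.sum_coe_sort u (fun a => (∑ v ∈ r, w v * c v a) - e a),
          Finset.sum_sub_distrib, hf1, he1, sub_self])
      (by
        rw [Finset.sum_coe_sort u (fun a => ((∑ v ∈ r, w v * c v a) - e a) • a)]
        simp_rw [sub_smul]
        rw [Finset.sum_sub_distrib, hfx, hex, sub_self])
    intro a ha
    exact sub_eq_zero.1 (h ⟨a, ha⟩ (Finset.mem_univ _))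
  have hrw : ∀ v ∈ r, v ∉ r.filter (fun v => w v ≠ 0) → w v = 0 := by
    intro v hv h
    by_contra h0
    exact h (Finset.mem_filter.2 ⟨hv, h0⟩)
  have hsub : r.filter (fun v => w v ≠ 0) ⊆ r := Finset.filter_subset _ _
  have hs1 : ∑ v ∈ r.filter (fun v => w v ≠ 0), w v = 1 := by
    rw [← hw1]; exact Finset.sum_subset hsub hrw
  refine ⟨r.filter (fun v => w v ≠ 0), X'.down_closed hr hsub ?_, ?_, ?_⟩
  · by_contra hne
    rw [Finset.not_nonempty_iff_eq_empty] at hne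
    rw [hne] at hs1
    simp at hs1
  · refine Finset.mem_convexHull'.2 ⟨w, fun v hv => hw0 v (hsub hv), hs1, ?_⟩
    rw [← hwx]
    exact Finset.sum_subset hsub fun v hv h => by rw [hrw v hv h, zero_smul]
  · intro v hv
    obtain ⟨hvr, hvw⟩ := Finset.mem_filter.1 (Finset.mem_coe.1 hv)
    obtain ⟨c0, c1, cx⟩ := hc v hvr
    have hca : ∀ a ∈ u, a ∉ u ∩ s → c v a = 0 := by
      intro a ha has
      have h1 := hz a ha
      have h2 : e a = 0 := if_neg fun h => has (Finset.mem_inter.2 ⟨ha, h⟩)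
      rw [h2, Finset.sum_eq_zero_iff_of_nonneg
        (fun v hv => mul_nonneg (hw0 v hv) ((hc v hv).1 a ha))] at h1
      exact (mul_eq_zero.1 (h1 v hvr)).resolve_left hvw
    have hin : u ∩ s ⊆ u := Finset.inter_subset_left
    refine convexHull_mono (Finset.coe_subset.2 (Finset.inter_subset_right (s₁ := u)))
      (Finset.mem_convexHull'.2 ⟨c v, fun a ha => c0 a (hin ha), ?_, ?_⟩)
    · rw [← c1]; exact Finset.sum_subset hin hca
    · refine (Finset.sum_subset hin fun a ha h => ?_).trans cx
      rw [hca a ha h, zero_smul]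

/-- Let `X'` be a refinement of `X` (same polyhedron, each face of `X'`
contained in a face of `X`), and let `I` be a topological embedding of the polyhedron
into `ℝⁿ` (here: into any normed target `F`).  If `I` has combinatorial thickness at
least `T` with respect to `X'`, then it also has combinatorial thickness at least `T`
with respect to `X`. -/
theorem statement6 {E : Type*} [NormedAddCommGroup E] [NormedSpace ℝ E]
    (n : ℕ)
    (X X' : Geometry.SimplicialComplex ℝ E)
    (hXfin : X.faces.Finite) (hX'fin : X'.faces.Finite)
    (hspace : X'.space = X.space)
    (href : ∀ s' ∈ X'.faces, ∃ s ∈ X.faces,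
      convexHull ℝ (s' : Set E) ⊆ convexHull ℝ (s : Set E))
    (I : X.space → EuclideanSpace ℝ (Fin n))
    (hIc : Continuous I) (hIinj : Function.Injective I)
    (T : ℝ) (hT : 0 < T)
    (hthick' : ∀ s' ∈ X'.faces, ∀ t' ∈ X'.faces, Disjoint s' t' →
      ∀ x y : X.space, (x : E) ∈ convexHull ℝ (s' : Set E) →
        (y : E) ∈ convexHull ℝ (t' : Set E) → T ≤ dist (I x) (I y)) :
    HasCombThickness X I T := by
  intro s hs t ht hst x y hx hy
  obtain ⟨s', hs', hxs', hss'⟩ := aux_carrier X X' hspace href s hs x hx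
  obtain ⟨t', ht', hyt', htt'⟩ := aux_carrier X X' hspace href t ht y hy
  refine hthick' s' hs' t' ht' ?_ x y hxs' hyt'
  rw [Finset.disjoint_left]
  intro v hvs hvt
  have h := X.inter_subset_convexHull hs ht ⟨hss' hvs, htt' hvt⟩
  rw [← Finset.coe_inter, Finset.disjoint_iff_inter_eq_empty.1 hst, Finset.coe_empty,
    convexHull_empty] at h
  exact h
end
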